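/- Let n ≥ 1 and let Φ : [0,∞) → [0,∞) be a convex bijection such that Φ satisfies the Δ₂-condition (there is C₁ > 0 with Φ(2t) ≤ C₁Φ(t) for all t > 0) and the ∇₂-condition (there is C₂ > 1 with Φ(2t) ≥ 2C₂Φ(t) for all t ≥ 0). Let 1 < p < ∞ and let N : [1,∞) → (0,∞) be increasing. Then there exists a constant C > 0 such that ‖f‖_{L^Φ} ≤ C‖g‖_{L^Φ} for every pair (f,g) ∈ F(p,N), where ‖h‖_{L^Φ} := inf({λ > 0 : ∫_{ℝⁿ} Φ(|h(x)|/λ) dx ≤ 1} ∪ {∞}) is the Luxemburg–Nakano norm. -/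

import Mathlib

open MeasureTheory ENNReal NNReal Filter Topology

noncomputable section

/-- Euclidean space ℝⁿ. -/
abbrev Eucl (n : ℕ) := EuclideanSpace ℝ (Fin n)

/-- The axes-parallel closed cube with center `x` and radius `r`. -/
def cubeSet {n : ℕ} (x : Eucl n) (r : ℝ) : Set (Eucl n) :=
  {y | ∀ i, |x i - y i| ≤ r}

/-- The Muckenhoupt `A_p` characteristic
`[w]_{A_p} = sup_Q (|Q|⁻¹∫_Q w) (|Q|⁻¹∫_Q w^{-1/(p-1)})^{p-1}`. -/
def apConst (n : ℕ) (p : ℝ) (w : Eucl n → ℝ≥0∞) : ℝ≥0∞ :=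
  ⨆ (x : Eucl n) (r : ℝ) (_ : 0 < r),
    ((volume (cubeSet x r))⁻¹ * ∫⁻ y in cubeSet x r, w y) *
      ((volume (cubeSet x r))⁻¹ * ∫⁻ y in cubeSet x r, w y ^ (-(1/(p-1)))) ^ (p-1)

/-- A weight: measurable, positive and finite a.e. -/
def IsWeight {n : ℕ} (w : Eucl n → ℝ≥0∞) : Prop :=
  Measurable w ∧ ∀ᵐ x ∂(volume : Measure (Eucl n)), 0 < w x ∧ w x < ⊤

/-- `w ∈ A_p`. -/
def MemAp (n : ℕ) (p : ℝ) (w : Eucl n → ℝ≥0∞) : Prop :=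
  IsWeight w ∧ apConst n p w < ⊤

/-- The weighted Lebesgue norm, for an `ℝ≥0∞`-valued function. -/
def wLpE (n : ℕ) (p : ℝ) (w : Eucl n → ℝ≥0∞) (F : Eucl n → ℝ≥0∞) : ℝ≥0∞ :=
  (∫⁻ x, F x ^ p * w x) ^ (1/p)

/-- The weighted Lebesgue norm `‖f‖_{L^p(w)} = (∫ |f|^p w)^{1/p}`. -/
def wLp (n : ℕ) (p : ℝ) (w : Eucl n → ℝ≥0∞) (f : Eucl n → ℝ) : ℝ≥0∞ :=
  wLpE n p w (fun x => (‖f x‖₊ : ℝ≥0∞))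

/-- The extrapolation family `F(p,N)`: pairs of measurable functions `(f,g)` with
`‖f‖_{L^p(w)} ≤ N([w]_{A_p}) ‖g‖_{L^p(w)}` for every `w ∈ A_p`. -/
def memF (n : ℕ) (p : ℝ) (N : ℝ → ℝ) (f g : Eucl n → ℝ) : Prop :=
  Measurable f ∧ Measurable g ∧
    ∀ w : Eucl n → ℝ≥0∞, MemAp n p w →
      wLp n p w f ≤ ENNReal.ofReal (N ((apConst n p w).toReal)) * wLp n p w g

/-- The Luxemburg–Nakano norm associated with a Young function `Φ`
(`sInf ∅ = ∞` in `ℝ≥0∞`). -/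
def luxNorm (n : ℕ) (Φ : ℝ → ℝ) (h : Eucl n → ℝ) : ℝ≥0∞ :=
  sInf {t : ℝ≥0∞ | ∃ l : ℝ, 0 < l ∧ t = ENNReal.ofReal l ∧
    ∫⁻ x : Eucl n, ENNReal.ofReal (Φ (|h x| / l)) ≤ 1}

/-! ### Conjugate functions -/

def yconj (E : ℝ≥0 → ℝ≥0∞) (s : ℝ≥0∞) : ℝ≥0∞ := ⨆ t : ℝ≥0, (s * t - E t)

lemma yconj_young (E : ℝ≥0 → ℝ≥0∞) (s : ℝ≥0∞) (t : ℝ≥0) : s * t ≤ E t + yconj E s :=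
  tsub_le_iff_left.mp (le_iSup (fun t : ℝ≥0 => s * t - E t) t)

lemma yconj_le_iff (E : ℝ≥0 → ℝ≥0∞) (s b : ℝ≥0∞) :
    yconj E s ≤ b ↔ ∀ t : ℝ≥0, s * t ≤ E t + b := by
  simp only [yconj, iSup_le_iff, tsub_le_iff_left]

lemma yconj_mono (E : ℝ≥0 → ℝ≥0∞) : Monotone (yconj E) := by
  intro s s' h
  rw [yconj_le_iff]
  intro t
  exact le_trans (by gcongr) (yconj_young E s' t)

lemma yconj_measurable (E : ℝ≥0 → ℝ≥0∞) : Measurable (yconj E) := (yconj_mono E).measurable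

lemma yconj_zero (E : ℝ≥0 → ℝ≥0∞) : yconj E 0 = 0 := by
  rw [← nonpos_iff_eq_zero, yconj_le_iff]
  intro t; simp

lemma yconj_smul_le (E : ℝ≥0 → ℝ≥0∞) (θ : ℝ≥0∞) (hθ : θ ≤ 1) (s : ℝ≥0∞) :
    yconj E (θ * s) ≤ θ * yconj E s := by
  rw [yconj_le_iff]
  intro t
  calc θ * s * t = θ * (s * t) := mul_assoc _ _ _
    _ ≤ θ * (E t + yconj E s) := by gcongr; exact yconj_young E s t
    _ = θ * E t + θ * yconj E s := mul_add _ _ _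
    _ ≤ 1 * E t + θ * yconj E s := by gcongr
    _ = _ := by rw [one_mul]

lemma yconj_tsum_le (E : ℝ≥0 → ℝ≥0∞) (c : ℕ → ℝ≥0∞) (hc : ∑' k, c k = 1) (x : ℕ → ℝ≥0∞) :
    yconj E (∑' k, c k * x k) ≤ ∑' k, c k * yconj E (x k) := by
  rw [yconj_le_iff]
  intro t
  calc (∑' k, c k * x k) * t = ∑' k, c k * (x k * t) := by
        rw [← ENNReal.tsum_mul_right]; simp only [mul_assoc]
    _ ≤ ∑' k, (c k * E t + c k * yconj E (x k)) := by
        refine ENNReal.tsum_le_tsum fun k => ?_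
        rw [← mul_add]; gcongr; exact yconj_young E _ t
    _ = E t + ∑' k, c k * yconj E (x k) := by
        rw [ENNReal.tsum_add, ENNReal.tsum_mul_right, hc, one_mul]

lemma yconj_half (E : ℝ≥0 → ℝ≥0∞) (x y : ℝ≥0∞) :
    yconj E ((x + y) / 2) ≤ (yconj E x + yconj E y) / 2 := by
  rw [yconj_le_iff]
  intro t
  calc (x + y) / 2 * t = (x * t + y * t) / 2 := by
        simp only [div_eq_mul_inv]; ring
    _ ≤ ((E t + yconj E x) + (E t + yconj E y)) / 2 := by
        gcongr <;> exact yconj_young E _ t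
    _ = (E t + E t) / 2 + (yconj E x + yconj E y) / 2 := by
        simp only [div_eq_mul_inv]; ring
    _ = _ := by rw [ENNReal.add_div, ENNReal.add_halves]

lemma yconj_top (E : ℝ≥0 → ℝ≥0∞) (t₀ : ℝ≥0) (h0 : 0 < t₀) (hE : E t₀ ≠ ⊤) :
    yconj E ⊤ = ⊤ := by
  have h := yconj_young E ⊤ t₀
  rw [ENNReal.top_mul (by exact_mod_cast h0.ne'), top_le_iff, ENNReal.add_eq_top] at h
  exact h.resolve_left hE

lemma yconj_top_iSup (E : ℝ≥0 → ℝ≥0∞) (t₀ : ℝ≥0) (h0 : 0 < t₀) (hE : E t₀ ≠ ⊤)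
    (a : ℝ≥0) (ha : 1 < a) : ⨆ k : ℕ, yconj E ((a : ℝ≥0∞) ^ (k + 1)) = ⊤ := by
  by_contra hne
  set S := ⨆ k : ℕ, yconj E ((a : ℝ≥0∞) ^ (k + 1)) with hS
  have h1 : ∀ k : ℕ, (a : ℝ≥0∞) ^ (k + 1) * t₀ ≤ E t₀ + S := fun k =>
    (yconj_young E _ t₀).trans (by gcongr; exact le_iSup (fun k : ℕ => yconj E ((a : ℝ≥0∞) ^ (k + 1))) k)
  have hfin : E t₀ + S ≠ ⊤ := ENNReal.add_ne_top.2 ⟨hE, hne⟩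
  lift E t₀ + S to ℝ≥0 using hfin with Z
  obtain ⟨k, hk⟩ := pow_unbounded_of_one_lt (Z / t₀) ha
  have h2 := h1 k
  have h3 : a ^ (k + 1) * t₀ ≤ Z := by exact_mod_cast h2
  rw [div_lt_iff₀ h0] at hk
  have : a ^ k * t₀ ≤ a ^ (k + 1) * t₀ := by
    gcongr
    · exact ha.le
    · omega
  exact absurd (this.trans h3) (not_le.2 hk)

lemma yconj_grow (E : ℝ≥0 → ℝ≥0∞) (A b : ℝ≥0) (hb : 0 < b)
    (hE : ∀ t, E (b * t) ≤ A * E t) (s : ℝ≥0∞) :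
    A * yconj E s ≤ yconj E ((A / b : ℝ≥0) * s) := by
  rw [yconj, ENNReal.mul_iSup]
  refine iSup_le fun t => ?_
  rw [ENNReal.mul_sub (fun _ _ => by simp)]
  refine le_trans ?_ (le_iSup _ (b * t))
  have : ((A / b : ℝ≥0) : ℝ≥0∞) * s * ((b * t : ℝ≥0) : ℝ≥0∞) = A * (s * t) := by
    have h : (A / b * (b * t) : ℝ≥0) = A * t := by field_simp
    calc _ = ((A / b * (b * t) : ℝ≥0) : ℝ≥0∞) * s := by push_cast; ring
      _ = _ := by rw [h]; push_cast; ring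
  rw [this]
  exact tsub_le_tsub_left (hE t) _

lemma yconj_dbl (E : ℝ≥0 → ℝ≥0∞) (A b : ℝ≥0) (hb : 0 < b)
    (hE : ∀ t, A * E t ≤ E (b * t)) (s : ℝ≥0∞) :
    yconj E ((A / b : ℝ≥0) * s) ≤ A * yconj E s := by
  rw [yconj_le_iff]
  intro t
  have ht : t = b * (t / b) := by field_simp
  calc ((A / b : ℝ≥0) : ℝ≥0∞) * s * t = A * (s * (t / b : ℝ≥0)) := by
        have h : (A / b * t : ℝ≥0) = A * (t / b) := by field_simp
        calc _ = ((A / b * t : ℝ≥0) : ℝ≥0∞) * s := by push_cast; ring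
          _ = _ := by rw [h]; push_cast; ring
    _ ≤ A * (E (t / b) + yconj E s) := by gcongr; exact yconj_young E s _
    _ = A * E (t / b) + A * yconj E s := mul_add _ _ _
    _ ≤ E (b * (t / b)) + A * yconj E s := by gcongr; exact hE _
    _ = _ := by rw [← ht]

lemma yconj_yconj_le (E : ℝ≥0 → ℝ≥0∞) (s : ℝ≥0) :
    yconj (fun t : ℝ≥0 => yconj E t) s ≤ E s := by
  rw [yconj_le_iff]
  intro t
  rw [mul_comm, add_comm]
  exact yconj_young E t s

/-! ### The maximal function -/

lemma cubeSet_eq {n : ℕ} (c : Eucl n) (r : ℝ) (hr : 0 ≤ r) :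
    cubeSet c r = (WithLp.ofLp : Eucl n → (Fin n → ℝ)) ⁻¹' Metric.closedBall (WithLp.ofLp c) r := by
  ext y
  simp only [cubeSet, Set.mem_ofPred_eq, Set.mem_preimage, Metric.mem_closedBall,
    dist_pi_le_iff hr, Real.dist_eq]
  refine forall_congr' fun i => ?_
  rw [abs_sub_comm]

lemma cubeSet_isClosed {n : ℕ} (c : Eucl n) (r : ℝ) : IsClosed (cubeSet c r) := by
  simp only [cubeSet, Set.ofPred_forall]
  refine isClosed_iInter fun i => ?_
  exact isClosed_le (by fun_prop) (by fun_prop)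

lemma cubeSet_measurable {n : ℕ} (c : Eucl n) (r : ℝ) : MeasurableSet (cubeSet c r) :=
  (cubeSet_isClosed c r).measurableSet

lemma volume_cubeSet {n : ℕ} (c : Eucl n) (r : ℝ) (hr : 0 ≤ r) :
    volume (cubeSet c r) = ENNReal.ofReal ((2 * r) ^ n) := by
  rw [cubeSet_eq c r hr, (PiLp.volume_preserving_ofLp (Fin n)).measure_preimage
    (Metric.isClosed_closedBall.measurableSet.nullMeasurableSet), Real.volume_pi_closedBall _ hr]
  simp

lemma volume_cubeSet_ne_zero {n : ℕ} (c : Eucl n) (r : ℝ) (hr : 0 < r) :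
    volume (cubeSet c r) ≠ 0 := by
  rw [volume_cubeSet c r hr.le, Ne, ENNReal.ofReal_eq_zero, not_le]; positivity

lemma volume_cubeSet_ne_top {n : ℕ} (c : Eucl n) (r : ℝ) (hr : 0 < r) :
    volume (cubeSet c r) ≠ ⊤ := by
  rw [volume_cubeSet c r hr.le]; exact ENNReal.ofReal_ne_top

def avgC {n : ℕ} (g : Eucl n → ℝ≥0∞) (c : Eucl n) (r : ℝ) : ℝ≥0∞ :=
  (volume (cubeSet c r))⁻¹ * ∫⁻ y in cubeSet c r, g y

def Mx {n : ℕ} (g : Eucl n → ℝ≥0∞) (x : Eucl n) : ℝ≥0∞ :=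
  ⨆ (c : Eucl n) (r : ℝ) (_ : 0 < r) (_ : ∀ i, |c i - x i| < 2 * r), avgC g c r

lemma lt_Mx_iff {n : ℕ} (g : Eucl n → ℝ≥0∞) (x : Eucl n) (t : ℝ≥0∞) :
    t < Mx g x ↔ ∃ (c : Eucl n) (r : ℝ), 0 < r ∧ (∀ i, |c i - x i| < 2 * r) ∧ t < avgC g c r := by
  simp only [Mx, lt_iSup_iff, exists_prop]

lemma avgC_le_Mx {n : ℕ} (g : Eucl n → ℝ≥0∞) (c : Eucl n) (r : ℝ) (hr : 0 < r) (x : Eucl n)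
    (hx : x ∈ cubeSet c r) : avgC g c r ≤ Mx g x := by
  unfold Mx
  refine le_iSup_of_le c <| le_iSup_of_le r <| le_iSup_of_le hr <| le_iSup_of_le ?_ le_rfl
  intro i
  have := hx i
  linarith

lemma Mx_measurable {n : ℕ} (g : Eucl n → ℝ≥0∞) : Measurable (Mx g) := by
  apply measurable_of_Ioi
  intro t
  have : Mx g ⁻¹' Set.Ioi t = ⋃ (c : Eucl n) (r : ℝ) (_ : 0 < r) (_ : t < avgC g c r),
      {x | ∀ i, |c i - x i| < 2 * r} := by
    ext x
    simp only [Set.mem_preimage, Set.mem_Ioi, lt_Mx_iff, Set.mem_iUnion, exists_prop,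
      Set.mem_ofPred_eq]
    constructor
    · rintro ⟨c, r, h1, h2, h3⟩; exact ⟨c, r, h1, h3, h2⟩
    · rintro ⟨c, r, h1, h2, h3⟩; exact ⟨c, r, h1, h3, h2⟩
  rw [this]
  apply IsOpen.measurableSet
  refine isOpen_iUnion fun c => isOpen_iUnion fun r => isOpen_iUnion fun _ => isOpen_iUnion fun _ => ?_
  simp only [Set.ofPred_forall]
  exact isOpen_iInter_of_finite fun i => isOpen_lt (by fun_prop) (by fun_prop)

lemma avgC_mono {n : ℕ} {g g' : Eucl n → ℝ≥0∞} (h : ∀ x, g x ≤ g' x) (c : Eucl n) (r : ℝ) :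
    avgC g c r ≤ avgC g' c r := by
  unfold avgC
  gcongr
  exact h _

lemma avgC_tsum {n : ℕ} (g : ℕ → Eucl n → ℝ≥0∞) (hg : ∀ k, Measurable (g k)) (c : Eucl n) (r : ℝ) :
    avgC (fun x => ∑' k, g k x) c r = ∑' k, avgC (g k) c r := by
  unfold avgC
  rw [lintegral_tsum (fun k => (hg k).aemeasurable), ENNReal.tsum_mul_left]

lemma avgC_const_mul {n : ℕ} (a : ℝ≥0∞) (g : Eucl n → ℝ≥0∞) (hg : Measurable g) (c : Eucl n) (r : ℝ) :
    avgC (fun x => a * g x) c r = a * avgC g c r := by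
  unfold avgC
  rw [lintegral_const_mul _ hg]; ring

lemma avgC_add_const_le {n : ℕ} (a : ℝ≥0∞) (g : Eucl n → ℝ≥0∞) (hg : Measurable g) (c : Eucl n)
    (r : ℝ) : avgC (fun x => g x + a) c r ≤ avgC g c r + a := by
  unfold avgC
  rw [lintegral_add_left hg, mul_add]
  gcongr
  simp only [lintegral_const, Measure.restrict_apply, MeasurableSet.univ, Set.univ_inter]
  calc (volume (cubeSet c r))⁻¹ * (a * volume (cubeSet c r))
      = a * ((volume (cubeSet c r))⁻¹ * volume (cubeSet c r)) := by ring
    _ ≤ a * 1 := by gcongr; exact ENNReal.inv_mul_le_one _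
    _ = a := mul_one a

lemma Mx_tsum_le {n : ℕ} (c : ℕ → ℝ≥0∞) (g : ℕ → Eucl n → ℝ≥0∞) (hg : ∀ k, Measurable (g k))
    (x : Eucl n) : Mx (fun x => ∑' k, c k * g k x) x ≤ ∑' k, c k * Mx (g k) x := by
  refine iSup_le fun z => iSup_le fun r => iSup_le fun hr => iSup_le fun hx => ?_
  rw [avgC_tsum _ (fun k => (hg k).const_mul _)]
  refine ENNReal.tsum_le_tsum fun k => ?_
  rw [avgC_const_mul _ _ (hg k)]
  gcongr
  exact le_iSup_of_le z <| le_iSup_of_le r <| le_iSup_of_le hr <| le_iSup_of_le hx le_rfl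

lemma weak_type {n : ℕ} (hn : 1 ≤ n) (g : Eucl n → ℝ≥0∞) (t : ℝ≥0∞) (ht0 : t ≠ 0)
    (ht : t ≠ ⊤) : volume {x | t < Mx g x} ≤ 10 ^ n / t * ∫⁻ x, g x := by
  by_cases hI : ∫⁻ x, g x = ⊤
  · rw [hI, ENNReal.mul_top]
    · exact le_top
    · exact (ENNReal.div_pos (by positivity) ht).ne'
  set T : Set (Eucl n × ℝ) := {q | 0 < q.2 ∧ t < avgC g q.1 q.2} with hT
  have hvol : ∀ q ∈ T, t * volume (cubeSet q.1 q.2) ≤ ∫⁻ y in cubeSet q.1 q.2, g y := by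
    rintro ⟨c, r⟩ ⟨hr, h⟩
    simp only at hr h ⊢
    unfold avgC at h
    rw [mul_comm, ← div_eq_mul_inv] at h
    rw [← ENNReal.le_div_iff_mul_le (Or.inl (volume_cubeSet_ne_zero c r hr))
      (Or.inl (volume_cubeSet_ne_top c r hr))]
    exact h.le
  have hbd : ∀ q ∈ T, 2 * q.2 ≤ 2 * (1 + ((∫⁻ x, g x) / t).toReal) := by
    rintro ⟨c, r⟩ hq
    have h1 := (hvol _ hq).trans (setLIntegral_le_lintegral _ _)
    have hr : 0 < r := hq.1
    simp only at h1 ⊢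
    rw [mul_comm, ← ENNReal.le_div_iff_mul_le (Or.inl ht0) (Or.inl ht), volume_cubeSet c r hr.le,
      ENNReal.ofReal_le_iff_le_toReal (ENNReal.div_lt_top hI ht0).ne] at h1
    have h3 : 0 ≤ ((∫⁻ x, g x) / t).toReal := ENNReal.toReal_nonneg
    by_cases h2 : 1 ≤ 2 * r
    · have : 2 * r ≤ (2 * r) ^ n := le_self_pow₀ h2 (by omega)
      linarith
    · linarith
  obtain ⟨u, huT, hdisj, hcov⟩ :=
    Vitali.exists_disjoint_subfamily_covering_enlargement_closedBall T
      (fun q => (WithLp.ofLp q.1 : Fin n → ℝ)) (fun q => 2 * q.2) _ hbd 5 (by norm_num)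
  have hu : u.Countable := by
    refine hdisj.countable_of_nonempty_interior fun q hq => ?_
    have : 0 < 2 * q.2 := by have := (huT hq).1; linarith
    exact ⟨WithLp.ofLp q.1, interior_mono Metric.ball_subset_closedBall
      (by rw [Metric.isOpen_ball.interior_eq]; exact Metric.mem_ball_self this)⟩
  have hsub : {x | t < Mx g x} ⊆ ⋃ q ∈ u, cubeSet q.1 (10 * q.2) := by
    intro x hx
    obtain ⟨c, r, hr, hxr, hav⟩ := (lt_Mx_iff g x t).1 hx
    obtain ⟨b, hb, hsubb⟩ := hcov (c, r) ⟨hr, hav⟩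
    refine Set.mem_iUnion₂.2 ⟨b, hb, ?_⟩
    have hb0 := (huT hb).1
    rw [cubeSet_eq _ _ (by linarith)]
    have hxx : x ∈ cubeSet c (2 * r) := fun i => (hxr i).le
    rw [cubeSet_eq _ _ (by linarith)] at hxx
    have := hsubb hxx
    simp only at this
    rw [Set.mem_preimage, show 10 * b.2 = 5 * (2 * b.2) by ring]
    exact this
  have hdisj' : u.PairwiseDisjoint (fun q => cubeSet q.1 q.2) := by
    intro a ha b hb hab
    have h := hdisj ha hb hab
    have ha0 := (huT ha).1
    have hb0 := (huT hb).1
    simp only [Function.onFun] at h ⊢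
    rw [cubeSet_eq _ _ ha0.le, cubeSet_eq _ _ hb0.le]
    refine Disjoint.preimage _ ?_
    exact h.mono (Metric.closedBall_subset_closedBall (by linarith))
      (Metric.closedBall_subset_closedBall (by linarith))
  have h10 : ∀ q ∈ u, volume (cubeSet q.1 (10 * q.2)) ≤ 10 ^ n / t * ∫⁻ y in cubeSet q.1 q.2, g y := by
    intro q hq
    have hq0 := (huT hq).1
    have hv := hvol q (huT hq)
    have : volume (cubeSet q.1 (10 * q.2)) = 10 ^ n * volume (cubeSet q.1 q.2) := by
      rw [volume_cubeSet _ _ (by linarith), volume_cubeSet _ _ hq0.le,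
        show 2 * (10 * q.2) = 10 * (2 * q.2) by ring, mul_pow, ENNReal.ofReal_mul (by positivity)]
      congr 1
      rw [ENNReal.ofReal_pow (by norm_num)]; norm_num
    rw [this]
    calc (10 : ℝ≥0∞) ^ n * volume (cubeSet q.1 q.2)
        = 10 ^ n / t * (t * volume (cubeSet q.1 q.2)) := by
          rw [← mul_assoc, ENNReal.div_mul_cancel ht0 ht]
      _ ≤ _ := by gcongr
  calc volume {x | t < Mx g x} ≤ volume (⋃ q ∈ u, cubeSet q.1 (10 * q.2)) := measure_mono hsub
    _ ≤ ∑' q : u, volume (cubeSet q.1.1 (10 * q.1.2)) := measure_biUnion_le _ hu _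
    _ ≤ ∑' q : u, 10 ^ n / t * ∫⁻ y in cubeSet q.1.1 q.1.2, g y :=
        ENNReal.tsum_le_tsum fun q => h10 q.1 q.2
    _ = 10 ^ n / t * ∑' q : u, ∫⁻ y in cubeSet q.1.1 q.1.2, g y := ENNReal.tsum_mul_left
    _ = 10 ^ n / t * ∫⁻ y in ⋃ q ∈ u, cubeSet q.1 q.2, g y := by
        rw [lintegral_biUnion hu (fun q _ => cubeSet_measurable _ _) hdisj']
    _ ≤ _ := by gcongr; exact Measure.restrict_le_self

lemma weak_type' {n : ℕ} (hn : 1 ≤ n) (g : Eucl n → ℝ≥0∞) (hg : Measurable g) (t : ℝ≥0∞)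
    (ht0 : t ≠ 0) (ht : t ≠ ⊤) :
    volume {x | t < Mx g x} ≤ (2 * 10 ^ n) / t * ∫⁻ x, {x | t / 2 < g x}.indicator g x := by
  have hms : MeasurableSet {x | t / 2 < g x} := measurableSet_lt measurable_const hg
  set g1 := {x | t / 2 < g x}.indicator g with hg1
  have hle : ∀ x, g x ≤ g1 x + t / 2 := by
    intro x
    by_cases h : t / 2 < g x
    · rw [hg1, Set.indicator_of_mem (by exact h)]; exact le_self_add
    · exact (not_lt.1 h).trans le_add_self
  have ht2 : t / 2 ≠ ⊤ := (ENNReal.div_lt_top ht (by norm_num)).ne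
  have ht20 : t / 2 ≠ 0 := (ENNReal.div_pos ht0 (by norm_num)).ne'
  have hsub : {x | t < Mx g x} ⊆ {x | t / 2 < Mx g1 x} := by
    intro x hx
    obtain ⟨c, r, hr, hxr, hav⟩ := (lt_Mx_iff g x t).1 hx
    refine (lt_Mx_iff g1 x _).2 ⟨c, r, hr, hxr, ?_⟩
    have h1 := (avgC_mono hle c r).trans (avgC_add_const_le (t / 2) g1 (hg.indicator hms) c r)
    have h2 := hav.trans_le h1
    rw [← ENNReal.add_halves t] at h2
    rw [ENNReal.add_halves t] at h2
    by_contra hcon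
    have h3 : avgC g1 c r + t / 2 ≤ t / 2 + t / 2 := by gcongr; exact not_lt.1 hcon
    rw [ENNReal.add_halves] at h3
    exact absurd (h2.trans_le h3) (lt_irrefl _)
  refine (measure_mono hsub).trans ((weak_type hn g1 _ ht20 ht2).trans_eq ?_)
  congr 1
  rw [div_eq_mul_inv, div_eq_mul_inv, div_eq_mul_inv, ENNReal.mul_inv (by simp) (by simp), inv_inv]
  ring

/-! ### Modular inequality for the maximal function -/

lemma step_A (E : ℝ≥0 → ℝ≥0∞) (t₀ : ℝ≥0) (h0 : 0 < t₀) (hE : E t₀ ≠ ⊤)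
    (a : ℝ≥0) (ha : 1 < a) (x : ℝ≥0∞) :
    yconj E x ≤ ∑' k : ℤ, yconj E ((a : ℝ≥0∞) ^ (k + 1)) * (if (a : ℝ≥0∞) ^ k < x then 1 else 0) := by
  have ha1 : (1 : ℝ≥0∞) < a := by exact_mod_cast ha
  have ha0 : (a : ℝ≥0∞) ≠ 0 := (zero_lt_one.trans ha1).ne'
  by_cases hx0 : x = 0
  · rw [hx0, yconj_zero]; exact zero_le
  by_cases hxt : x = ⊤
  · subst hxt
    refine (le_top.trans_eq (yconj_top_iSup E t₀ h0 hE a ha).symm).trans ?_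
    refine iSup_le fun k => ?_
    refine le_trans ?_ (ENNReal.le_tsum (k : ℤ))
    rw [if_pos (ENNReal.zpow_lt_top ha0 (by simp) _), mul_one]
    exact le_of_eq (by norm_cast)
  obtain ⟨k, hk1, hk2⟩ := ENNReal.exists_mem_Ioc_zpow hx0 hxt ha1 (by simp)
  refine le_trans ?_ (ENNReal.le_tsum k)
  rw [if_pos hk1, mul_one]
  exact yconj_mono E hk2

lemma tsum_int_geom (q : ℝ≥0∞) (m : ℤ) :
    ∑' k : ℤ, (if k ≤ m then q ^ (m - k).toNat else 0) = ∑' j : ℕ, q ^ j := by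
  have hinj : Function.Injective (fun j : ℕ => m - (j : ℤ)) := by
    intro i j h; simp only at h; omega
  rw [← hinj.tsum_eq]
  · refine tsum_congr fun j => ?_
    rw [if_pos (by omega)]
    congr 1; omega
  · intro k hk
    have : k ≤ m := by
      by_contra h
      simp [h] at hk
    exact ⟨(m - k).toNat, by simp only; omega⟩

lemma grow_iter (Ψ : ℝ≥0∞ → ℝ≥0∞) (a D : ℝ≥0) (ha : 1 < a)
    (hgrow : ∀ s, ((a * D : ℝ≥0) : ℝ≥0∞) * Ψ s ≤ Ψ (a * s)) (k : ℤ) (j : ℕ) :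
    ((a * D : ℝ≥0) : ℝ≥0∞) ^ j * Ψ ((a : ℝ≥0∞) ^ k) ≤ Ψ ((a : ℝ≥0∞) ^ (k + j)) := by
  have ha0 : (a : ℝ≥0∞) ≠ 0 := by exact_mod_cast (zero_lt_one.trans ha).ne'
  induction j with
  | zero => simp
  | succ j ih =>
    calc ((a * D : ℝ≥0) : ℝ≥0∞) ^ (j + 1) * Ψ ((a : ℝ≥0∞) ^ k)
        = ((a * D : ℝ≥0) : ℝ≥0∞) * (((a * D : ℝ≥0) : ℝ≥0∞) ^ j * Ψ ((a : ℝ≥0∞) ^ k)) := by ring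
      _ ≤ ((a * D : ℝ≥0) : ℝ≥0∞) * Ψ ((a : ℝ≥0∞) ^ (k + j)) := by gcongr
      _ ≤ Ψ (a * (a : ℝ≥0∞) ^ (k + j)) := hgrow _
      _ = _ := by
        congr 1
        rw [show (k + ((j + 1 : ℕ) : ℤ)) = 1 + (k + j) by push_cast; ring,
          ENNReal.zpow_add ha0 (by simp) 1, zpow_one]

lemma step_B (Ψ : ℝ≥0∞ → ℝ≥0∞) (hmono : Monotone Ψ) (a D : ℝ≥0) (ha : 1 < a) (hD : 1 < D)
    (hgrow : ∀ s, ((a * D : ℝ≥0) : ℝ≥0∞) * Ψ s ≤ Ψ (a * s)) (y : ℝ≥0∞) (hy : y ≠ ⊤) :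
    (∑' k : ℤ, Ψ ((a : ℝ≥0∞) ^ (k + 1)) * ((a : ℝ≥0∞) ^ k)⁻¹ *
      (if (a : ℝ≥0∞) ^ k < y then 1 else 0)) * y ≤
      a * (∑' j : ℕ, ((D⁻¹ : ℝ≥0) : ℝ≥0∞) ^ j) * Ψ (a * y) := by
  have ha1 : (1 : ℝ≥0∞) < a := by exact_mod_cast ha
  have ha0 : (a : ℝ≥0∞) ≠ 0 := (zero_lt_one.trans ha1).ne'
  have hat : (a : ℝ≥0∞) ≠ ⊤ := by simp
  have hD0 : D ≠ 0 := (zero_lt_one.trans hD).ne'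
  by_cases hy0 : y = 0
  · simp [hy0]
  obtain ⟨m, hm1, hm2⟩ := ENNReal.exists_mem_Ioc_zpow hy0 hy ha1 hat
  have hpow0 : ∀ k : ℤ, (a : ℝ≥0∞) ^ k ≠ 0 := fun k => (ENNReal.zpow_pos ha0 hat k).ne'
  have hpowt : ∀ k : ℤ, (a : ℝ≥0∞) ^ k ≠ ⊤ := fun k => (ENNReal.zpow_lt_top ha0 hat k).ne
  have hterm : ∀ k : ℤ, Ψ ((a : ℝ≥0∞) ^ (k + 1)) * ((a : ℝ≥0∞) ^ k)⁻¹ *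
      (if (a : ℝ≥0∞) ^ k < y then 1 else 0) ≤
      (if k ≤ m then ((D⁻¹ : ℝ≥0) : ℝ≥0∞) ^ (m - k).toNat else 0) *
        (Ψ ((a : ℝ≥0∞) ^ (m + 1)) * ((a : ℝ≥0∞) ^ m)⁻¹) := by
    intro k
    by_cases hk : (a : ℝ≥0∞) ^ k < y
    · have hkm : k ≤ m := by
        by_contra hcon
        have : (a : ℝ≥0∞) ^ (m + 1) ≤ (a : ℝ≥0∞) ^ k := ENNReal.zpow_le_of_le ha1.le (by omega)
        exact absurd (hk.trans_le (hm2.trans this)) (lt_irrefl _)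
      rw [if_pos hk, if_pos hkm, mul_one]
      obtain ⟨j, rfl⟩ : ∃ j : ℕ, m = k + j := ⟨(m - k).toNat, by omega⟩
      rw [show (k + (j : ℤ) - k).toNat = j by omega]
      have h := grow_iter Ψ a D ha hgrow (k + 1) j
      rw [show k + 1 + (j : ℤ) = k + j + 1 by ring] at h
      have hcoef : ((D⁻¹ : ℝ≥0) : ℝ≥0∞) ^ j * ((a * D : ℝ≥0) : ℝ≥0∞) ^ j = (a : ℝ≥0∞) ^ j := by
        rw [← mul_pow]
        congr 1
        rw [← ENNReal.coe_mul]
        congr 1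
        field_simp
      have hinv : (a : ℝ≥0∞) ^ j * ((a : ℝ≥0∞) ^ (k + j))⁻¹ = ((a : ℝ≥0∞) ^ k)⁻¹ := by
        rw [ENNReal.zpow_add ha0 hat, zpow_natCast, ENNReal.mul_inv (Or.inl (hpow0 k)) (Or.inl (hpowt k)),
          mul_comm, mul_assoc, ENNReal.inv_mul_cancel (pow_ne_zero _ ha0) (ENNReal.pow_ne_top hat), mul_one]
      calc Ψ ((a : ℝ≥0∞) ^ (k + 1)) * ((a : ℝ≥0∞) ^ k)⁻¹
          = ((D⁻¹ : ℝ≥0) : ℝ≥0∞) ^ j * ((((a * D : ℝ≥0) : ℝ≥0∞) ^ j * Ψ ((a : ℝ≥0∞) ^ (k + 1)))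
            * ((a : ℝ≥0∞) ^ (k + j))⁻¹) := by
            rw [← hinv, ← hcoef]; ring
        _ ≤ _ := by gcongr
    · rw [if_neg hk, mul_zero]; exact zero_le
  calc _ ≤ (∑' k : ℤ, (if k ≤ m then ((D⁻¹ : ℝ≥0) : ℝ≥0∞) ^ (m - k).toNat else 0) *
        (Ψ ((a : ℝ≥0∞) ^ (m + 1)) * ((a : ℝ≥0∞) ^ m)⁻¹)) * y := by
        exact mul_le_mul_left (ENNReal.tsum_le_tsum hterm) y
    _ = (∑' j : ℕ, ((D⁻¹ : ℝ≥0) : ℝ≥0∞) ^ j) * (Ψ ((a : ℝ≥0∞) ^ (m + 1)) * ((a : ℝ≥0∞) ^ m)⁻¹) * y := by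
        rw [ENNReal.tsum_mul_right, tsum_int_geom]
    _ ≤ (∑' j : ℕ, ((D⁻¹ : ℝ≥0) : ℝ≥0∞) ^ j) * (Ψ (a * y) * ((a : ℝ≥0∞) ^ m)⁻¹) *
          (a : ℝ≥0∞) ^ (m + 1) := by
        gcongr
        apply hmono
        rw [add_comm, ENNReal.zpow_add ha0 hat, zpow_one]
        gcongr
    _ = (∑' j : ℕ, ((D⁻¹ : ℝ≥0) : ℝ≥0∞) ^ j) * Ψ (a * y) * a *
          (((a : ℝ≥0∞) ^ m)⁻¹ * (a : ℝ≥0∞) ^ m) := by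
        rw [ENNReal.zpow_add ha0 hat, zpow_one]; ring
    _ = _ := by
        rw [ENNReal.inv_mul_cancel (hpow0 m) (hpowt m)]; ring

lemma maxi {n : ℕ} (hn : 1 ≤ n) (E : ℝ≥0 → ℝ≥0∞) (t₀ : ℝ≥0) (h0 : 0 < t₀) (hE : E t₀ ≠ ⊤)
    (a D : ℝ≥0) (ha : 1 < a) (hD : 1 < D)
    (hgrow : ∀ s, ((a * D : ℝ≥0) : ℝ≥0∞) * yconj E s ≤ yconj E (a * s)) :
    ∃ B : ℝ≥0, 0 < B ∧ ∀ g : Eucl n → ℝ≥0∞, Measurable g →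
      ∫⁻ x, yconj E (Mx g x / B) ≤ ∫⁻ x, yconj E (g x) := by
  have ha1 : (1 : ℝ≥0∞) < a := by exact_mod_cast ha
  have ha0 : (a : ℝ≥0∞) ≠ 0 := (zero_lt_one.trans ha1).ne'
  have hat : (a : ℝ≥0∞) ≠ ⊤ := by simp
  have hpow0 : ∀ k : ℤ, (a : ℝ≥0∞) ^ k ≠ 0 := fun k => (ENNReal.zpow_pos ha0 hat k).ne'
  have hpowt : ∀ k : ℤ, (a : ℝ≥0∞) ^ k ≠ ⊤ := fun k => (ENNReal.zpow_lt_top ha0 hat k).ne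
  set S : ℝ≥0∞ := ∑' j : ℕ, ((D⁻¹ : ℝ≥0) : ℝ≥0∞) ^ j with hS
  have hSt : S ≠ ⊤ := by
    rw [hS, ENNReal.tsum_geometric, Ne, ENNReal.inv_eq_top, tsub_eq_zero_iff_le, not_le]
    exact_mod_cast inv_lt_one_of_one_lt₀ hD
  have hKt : (10 : ℝ≥0∞) ^ n * a * S * (2 * a) ≠ ⊤ :=
    ENNReal.mul_ne_top (ENNReal.mul_ne_top (ENNReal.mul_ne_top (ENNReal.pow_ne_top (by simp)) hat) hSt)
      (ENNReal.mul_ne_top (by simp) hat)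
  set B : ℝ≥0 := max (2 * a) ((10 : ℝ≥0∞) ^ n * a * S * (2 * a)).toNNReal with hB
  have hB1 : 2 * a ≤ B := le_max_left _ _
  have hB2 : (10 : ℝ≥0∞) ^ n * a * S * (2 * a) ≤ B := by
    refine (ENNReal.coe_toNNReal hKt).symm.le.trans ?_
    exact ENNReal.coe_le_coe.2 (le_max_right _ _)
  have hBpos : 0 < B := lt_of_lt_of_le (by have := zero_lt_one.trans ha; positivity) hB1
  have hB0 : (B : ℝ≥0∞) ≠ 0 := by exact_mod_cast hBpos.ne'
  have hBt : (B : ℝ≥0∞) ≠ ⊤ := by simp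
  refine ⟨B, hBpos, fun g hg => ?_⟩
  have hMm := Mx_measurable g
  have hiff : ∀ (k : ℤ) (x : Eucl n), (a : ℝ≥0∞) ^ k < Mx g x / B ↔ (a : ℝ≥0∞) ^ k * B < Mx g x :=
    fun k x => ENNReal.lt_div_iff_mul_lt (Or.inl hB0) (Or.inl hBt)
  have hiff2 : ∀ (k : ℤ) (x : Eucl n), (a : ℝ≥0∞) ^ k * B / 2 < g x ↔
      (a : ℝ≥0∞) ^ k < 2 / B * g x := by
    intro k x
    rw [ENNReal.div_lt_iff (Or.inl (by simp)) (Or.inl (by simp)),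
      show 2 / (B : ℝ≥0∞) * g x = (g x * 2) / B by simp only [div_eq_mul_inv]; ring,
      ENNReal.lt_div_iff_mul_lt (Or.inl hB0) (Or.inl hBt)]
  have hpt : ∀ x, (∑' k : ℤ, yconj E ((a : ℝ≥0∞) ^ (k + 1)) * ((2 * 10 ^ n) / ((a : ℝ≥0∞) ^ k * B) *
      {x | (a : ℝ≥0∞) ^ k * B / 2 < g x}.indicator g x)) ≤ yconj E (g x) := by
    intro x
    by_cases hgt : g x = ⊤
    · rw [hgt, yconj_top E t₀ h0 hE]; exact le_top
    set y := 2 / (B : ℝ≥0∞) * g x with hy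
    have hyt : y ≠ ⊤ := ENNReal.mul_ne_top (ENNReal.div_lt_top (by simp) hB0).ne hgt
    have hgy : g x = B / 2 * y := by
      calc g x = ((B : ℝ≥0∞)⁻¹ * B) * (2 * 2⁻¹) * g x := by
            rw [ENNReal.inv_mul_cancel hB0 hBt, ENNReal.mul_inv_cancel (by simp) (by simp), mul_one,
              one_mul]
        _ = _ := by rw [hy]; simp only [div_eq_mul_inv]; ring
    have hcancel : (2 * 10 ^ n) * (B : ℝ≥0∞)⁻¹ * (B / 2) = 10 ^ n := by
      calc (2 * 10 ^ n) * (B : ℝ≥0∞)⁻¹ * (B / 2) = 10 ^ n * ((B : ℝ≥0∞)⁻¹ * B) * (2 * 2⁻¹) := by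
            rw [div_eq_mul_inv]; ring
        _ = 10 ^ n := by
            rw [ENNReal.inv_mul_cancel hB0 hBt, ENNReal.mul_inv_cancel (by simp) (by simp), mul_one, mul_one]
    calc _ = ∑' k : ℤ, 10 ^ n * ((yconj E ((a : ℝ≥0∞) ^ (k + 1)) * ((a : ℝ≥0∞) ^ k)⁻¹ *
            (if (a : ℝ≥0∞) ^ k < y then 1 else 0)) * y) := by
          refine tsum_congr fun k => ?_
          by_cases hk : (a : ℝ≥0∞) ^ k < y
          · have : x ∈ {x | (a : ℝ≥0∞) ^ k * B / 2 < g x} := (hiff2 k x).2 hk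
            rw [if_pos hk, Set.indicator_of_mem this, div_eq_mul_inv,
              ENNReal.mul_inv (Or.inl (hpow0 k)) (Or.inl (hpowt k))]
            conv_rhs => rw [← hcancel]
            rw [hgy]; ring
          · have : x ∉ {x | (a : ℝ≥0∞) ^ k * B / 2 < g x} := fun h => hk ((hiff2 k x).1 h)
            rw [if_neg hk, Set.indicator_of_notMem this]; simp
      _ = 10 ^ n * ((∑' k : ℤ, (yconj E ((a : ℝ≥0∞) ^ (k + 1)) * ((a : ℝ≥0∞) ^ k)⁻¹ *
            (if (a : ℝ≥0∞) ^ k < y then 1 else 0))) * y) := by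
          rw [ENNReal.tsum_mul_left, ENNReal.tsum_mul_right]
      _ ≤ 10 ^ n * (a * S * yconj E (a * y)) := by
          refine mul_le_mul_right ?_ _
          exact step_B _ (yconj_mono E) a D ha hD hgrow y hyt
      _ = 10 ^ n * (a * S * yconj E ((2 * a) / B * g x)) := by
          rw [hy, show (a : ℝ≥0∞) * (2 / B * g x) = (2 * a) / B * g x by
            simp only [div_eq_mul_inv]; ring]
      _ ≤ 10 ^ n * (a * S * ((2 * a) / B * yconj E (g x))) := by
          gcongr
          refine yconj_smul_le E _ ?_ _
          refine ENNReal.div_le_of_le_mul ?_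
          rw [one_mul]; exact_mod_cast hB1
      _ = (10 ^ n * a * S * (2 * a)) / B * yconj E (g x) := by simp only [div_eq_mul_inv]; ring
      _ ≤ 1 * yconj E (g x) := by
          gcongr
          refine ENNReal.div_le_of_le_mul ?_
          rw [one_mul]; exact hB2
      _ = _ := one_mul _
  calc ∫⁻ x, yconj E (Mx g x / B)
      ≤ ∫⁻ x, ∑' k : ℤ, yconj E ((a : ℝ≥0∞) ^ (k + 1)) *
          {x | (a : ℝ≥0∞) ^ k * B < Mx g x}.indicator (fun _ => 1) x := by
        refine lintegral_mono fun x => (step_A E t₀ h0 hE a ha _).trans (le_of_eq ?_)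
        refine tsum_congr fun k => ?_
        congr 1
        rw [Set.indicator_apply]
        simp only [Set.mem_ofPred_eq, hiff]
    _ = ∑' k : ℤ, yconj E ((a : ℝ≥0∞) ^ (k + 1)) * volume {x | (a : ℝ≥0∞) ^ k * B < Mx g x} := by
        have hms : ∀ k : ℤ, MeasurableSet {x | (a : ℝ≥0∞) ^ k * B < Mx g x} := fun k =>
          measurableSet_lt measurable_const hMm
        rw [lintegral_tsum (fun k => ((measurable_const.indicator (hms k)).const_mul _).aemeasurable)]
        refine tsum_congr fun k => ?_
        rw [lintegral_const_mul _ (measurable_const.indicator (hms k)), lintegral_indicator (hms k)]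
        simp
    _ ≤ ∑' k : ℤ, yconj E ((a : ℝ≥0∞) ^ (k + 1)) * ((2 * 10 ^ n) / ((a : ℝ≥0∞) ^ k * B) *
          ∫⁻ x, {x | (a : ℝ≥0∞) ^ k * B / 2 < g x}.indicator g x) := by
        gcongr with k
        exact weak_type' hn g hg _ (mul_ne_zero (hpow0 k) hB0) (ENNReal.mul_ne_top (hpowt k) hBt)
    _ = ∫⁻ x, ∑' k : ℤ, yconj E ((a : ℝ≥0∞) ^ (k + 1)) * ((2 * 10 ^ n) / ((a : ℝ≥0∞) ^ k * B) *
          {x | (a : ℝ≥0∞) ^ k * B / 2 < g x}.indicator g x) := by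
        have hms : ∀ k : ℤ, Measurable ({x | (a : ℝ≥0∞) ^ k * B / 2 < g x}.indicator g) := fun k =>
          hg.indicator (measurableSet_lt measurable_const hg)
        rw [lintegral_tsum (fun k => (((hms k).const_mul _).const_mul _).aemeasurable)]
        refine tsum_congr fun k => ?_
        rw [lintegral_const_mul _ ((hms k).const_mul _), lintegral_const_mul _ (hms k)]
    _ ≤ _ := lintegral_mono hpt

/-! ### Rubio de Francia iteration -/

def itM {n : ℕ} (B : ℝ≥0) (h : Eucl n → ℝ≥0∞) : ℕ → Eucl n → ℝ≥0∞
  | 0 => h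
  | k + 1 => fun x => Mx (itM B h k) x / B

lemma itM_measurable {n : ℕ} (B : ℝ≥0) (h : Eucl n → ℝ≥0∞) (hh : Measurable h) (k : ℕ) :
    Measurable (itM B h k) := by
  cases k with
  | zero => exact hh
  | succ k => exact (Mx_measurable _).div_const _

lemma exists_majorant {n : ℕ} (E : ℝ≥0 → ℝ≥0∞) (B : ℝ≥0) (hB : 0 < B)
    (hmax : ∀ g : Eucl n → ℝ≥0∞, Measurable g →
      ∫⁻ x, yconj E (Mx g x / B) ≤ ∫⁻ x, yconj E (g x))
    (h : Eucl n → ℝ≥0∞) (hh : Measurable h) :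
    ∃ u : Eucl n → ℝ≥0∞, Measurable u ∧ (∀ x, h x ≤ 2 * u x) ∧
      (∀ x, Mx u x ≤ ((2 * B : ℝ≥0) : ℝ≥0∞) * u x) ∧
      ∫⁻ x, yconj E (u x) ≤ ∫⁻ x, yconj E (h x) := by
  have hB0 : (B : ℝ≥0∞) ≠ 0 := by exact_mod_cast hB.ne'
  have hBt : (B : ℝ≥0∞) ≠ ⊤ := by simp
  have hm := itM_measurable B h hh
  have hc : ∑' k : ℕ, (2⁻¹ : ℝ≥0∞) ^ (k + 1) = 1 := by
    rw [ENNReal.tsum_geometric_add_one, ENNReal.one_sub_inv_two, inv_inv,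
      ENNReal.inv_mul_cancel (by simp) (by simp)]
  refine ⟨fun x => ∑' k : ℕ, (2⁻¹ : ℝ≥0∞) ^ (k + 1) * itM B h k x, ?_, ?_, ?_, ?_⟩
  · exact Measurable.tsum fun k => (hm k).const_mul _
  · intro x
    calc h x = 2 * ((2⁻¹ : ℝ≥0∞) ^ (0 + 1) * itM B h 0 x) := by
          rw [zero_add, pow_one, ← mul_assoc, ENNReal.mul_inv_cancel (by simp) (by simp), one_mul]; rfl
      _ ≤ _ := by
        gcongr
        exact ENNReal.le_tsum (f := fun k : ℕ => (2⁻¹ : ℝ≥0∞) ^ (k + 1) * itM B h k x) 0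
  · intro x
    refine (Mx_tsum_le _ _ hm x).trans ?_
    calc ∑' k : ℕ, (2⁻¹ : ℝ≥0∞) ^ (k + 1) * Mx (itM B h k) x
        = ∑' k : ℕ, ((2 * B : ℝ≥0) : ℝ≥0∞) * ((2⁻¹ : ℝ≥0∞) ^ (k + 1 + 1) * itM B h (k + 1) x) := by
          refine tsum_congr fun k => ?_
          have h2 : (2 : ℝ≥0∞) * 2⁻¹ = 1 := ENNReal.mul_inv_cancel (by simp) (by simp)
          have h3 : (B : ℝ≥0∞) * (B : ℝ≥0∞)⁻¹ = 1 := ENNReal.mul_inv_cancel hB0 hBt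
          calc (2⁻¹ : ℝ≥0∞) ^ (k + 1) * Mx (itM B h k) x
              = (2⁻¹ : ℝ≥0∞) ^ (k + 1) * Mx (itM B h k) x * (2 * 2⁻¹) * ((B : ℝ≥0∞) * (B : ℝ≥0∞)⁻¹) := by
                rw [h2, h3, mul_one, mul_one]
            _ = _ := by
                simp only [itM, div_eq_mul_inv]; push_cast; ring
      _ = ((2 * B : ℝ≥0) : ℝ≥0∞) * ∑' k : ℕ, ((2⁻¹ : ℝ≥0∞) ^ (k + 1 + 1) * itM B h (k + 1) x) :=
          ENNReal.tsum_mul_left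
      _ ≤ _ := by
          gcongr
          exact ENNReal.tsum_comp_le_tsum_of_injective (add_left_injective 1)
            (fun k : ℕ => (2⁻¹ : ℝ≥0∞) ^ (k + 1) * itM B h k x)
  · have hk : ∀ k, ∫⁻ x, yconj E (itM B h k x) ≤ ∫⁻ x, yconj E (h x) := by
      intro k
      induction k with
      | zero => exact le_rfl
      | succ k ih => exact (hmax _ (hm k)).trans ih
    calc ∫⁻ x, yconj E (∑' k : ℕ, (2⁻¹ : ℝ≥0∞) ^ (k + 1) * itM B h k x)
        ≤ ∫⁻ x, ∑' k : ℕ, (2⁻¹ : ℝ≥0∞) ^ (k + 1) * yconj E (itM B h k x) :=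
          lintegral_mono fun x => yconj_tsum_le E _ hc _
      _ = ∑' k : ℕ, (2⁻¹ : ℝ≥0∞) ^ (k + 1) * ∫⁻ x, yconj E (itM B h k x) := by
          have hmm : ∀ k, Measurable fun x => yconj E (itM B h k x) := fun k =>
            (yconj_measurable E).comp (hm k)
          rw [lintegral_tsum (fun k => ((hmm k).const_mul _).aemeasurable)]
          exact tsum_congr fun k => lintegral_const_mul _ (hmm k)
      _ ≤ ∑' k : ℕ, (2⁻¹ : ℝ≥0∞) ^ (k + 1) * ∫⁻ x, yconj E (h x) := by
          exact ENNReal.tsum_le_tsum fun k => mul_le_mul_right (hk k) _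
      _ = _ := by rw [ENNReal.tsum_mul_right, hc, one_mul]

/-! ### The weight -/

lemma inv_le_of_le_mul {x y θ : ℝ≥0∞} (h0 : θ ≠ 0) (ht : θ ≠ ⊤) (h : y ≤ θ * x) :
    x⁻¹ ≤ θ * y⁻¹ := by
  calc x⁻¹ = θ * (θ * x)⁻¹ := by
        rw [ENNReal.mul_inv (Or.inl h0) (Or.inl ht), ← mul_assoc, ENNReal.mul_inv_cancel h0 ht, one_mul]
    _ ≤ _ := by gcongr

lemma avgC_good {n : ℕ} (u : Eucl n → ℝ≥0∞) (hu : Measurable u) (hpos : ∀ x, 0 < u x)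
    (hfin : ∀ᵐ x, u x < ⊤) (K : ℝ≥0) (hM : ∀ x, Mx u x ≤ K * u x)
    (c : Eucl n) (r : ℝ) (hr : 0 < r) : avgC u c r ≠ 0 ∧ avgC u c r ≠ ⊤ := by
  constructor
  · unfold avgC
    refine mul_ne_zero (ENNReal.inv_ne_zero.2 (volume_cubeSet_ne_top c r hr)) ?_
    rw [Ne, setLIntegral_eq_zero_iff (cubeSet_measurable c r) hu]
    intro h
    apply volume_cubeSet_ne_zero c r hr
    refine measure_mono_null (t := {x | ¬ (x ∈ cubeSet c r → u x = 0)}) ?_ h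
    intro x hx hcon
    exact (hpos x).ne' (hcon hx)
  · have : ∃ x ∈ cubeSet c r, u x < ⊤ := by
      by_contra hcon
      push Not at hcon
      apply volume_cubeSet_ne_zero c r hr
      refine measure_mono_null (t := {x | ¬ (u x < ⊤)}) ?_ hfin
      intro x hx
      exact not_lt.2 (hcon x hx)
    obtain ⟨x, hx, hux⟩ := this
    exact ((avgC_le_Mx u c r hr x hx).trans (hM x)).trans_lt (ENNReal.mul_lt_top (by simp) hux) |>.ne

lemma ap_bound {n : ℕ} (p : ℝ) (hp : 1 < p) (u v : Eucl n → ℝ≥0∞)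
    (hu : Measurable u) (hv : Measurable v) (hupos : ∀ x, 0 < u x) (hvpos : ∀ x, 0 < v x)
    (hufin : ∀ᵐ x, u x < ⊤) (hvfin : ∀ᵐ x, v x < ⊤) (K₁ K₂ : ℝ≥0) (hK₁ : 0 < K₁) (hK₂ : 0 < K₂)
    (hMu : ∀ x, Mx u x ≤ K₁ * u x) (hMv : ∀ x, Mx v x ≤ K₂ * v x) :
    apConst n p (fun x => u x ^ (1 - p) * v x) ≤ (K₁ : ℝ≥0∞) ^ (p - 1) * K₂ := by
  refine iSup_le fun c => iSup_le fun r => iSup_le fun hr => ?_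
  have hp1 : 0 < p - 1 := by linarith
  set s := 1 / (p - 1) with hs
  have hs0 : 0 < s := by positivity
  have hsp : s * (p - 1) = 1 := by rw [hs]; field_simp
  obtain ⟨hU0, hUt⟩ := avgC_good u hu hupos hufin K₁ hMu c r hr
  obtain ⟨hV0, hVt⟩ := avgC_good v hv hvpos hvfin K₂ hMv c r hr
  set U := avgC u c r with hU
  set V := avgC v c r with hV
  have hK₁0 : (K₁ : ℝ≥0∞) ≠ 0 := by exact_mod_cast hK₁.ne'
  have hK₂0 : (K₂ : ℝ≥0∞) ≠ 0 := by exact_mod_cast hK₂.ne'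
  have h1 : ∀ x ∈ cubeSet c r, u x ^ (1 - p) * v x ≤ ((K₁ : ℝ≥0∞) ^ (p - 1) * (U ^ (p - 1))⁻¹) * v x := by
    intro x hx
    gcongr
    have : u x ^ (1 - p) = (u x ^ (p - 1))⁻¹ := by rw [← ENNReal.rpow_neg]; congr 1; ring
    rw [this]
    refine inv_le_of_le_mul (by simp [ENNReal.rpow_eq_zero_iff, hK₁.ne'])
      (ENNReal.rpow_ne_top_of_nonneg hp1.le (by simp)) ?_
    rw [← ENNReal.mul_rpow_of_nonneg _ _ hp1.le]
    exact ENNReal.rpow_le_rpow ((avgC_le_Mx u c r hr x hx).trans (hMu x)) hp1.le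
  have h2 : ∀ᵐ x, x ∈ cubeSet c r → (u x ^ (1 - p) * v x) ^ (-s) ≤
      ((K₂ : ℝ≥0∞) ^ s * (V ^ s)⁻¹) * u x := by
    filter_upwards [hufin, hvfin] with x hux hvx hx
    have hux0 := (hupos x).ne'
    rw [ENNReal.mul_rpow_of_ne_zero (by
      rw [Ne, ENNReal.rpow_eq_zero_iff]; push Not
      exact ⟨fun h => absurd h hux0, fun h => absurd h hux.ne⟩) (hvpos x).ne', ← ENNReal.rpow_mul,
      show (1 - p) * -s = 1 by linarith, ENNReal.rpow_one, mul_comm]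
    gcongr
    rw [ENNReal.rpow_neg]
    refine inv_le_of_le_mul (by simp [ENNReal.rpow_eq_zero_iff, hK₂.ne'])
      (ENNReal.rpow_ne_top_of_nonneg hs0.le (by simp)) ?_
    rw [← ENNReal.mul_rpow_of_nonneg _ _ hs0.le]
    exact ENNReal.rpow_le_rpow ((avgC_le_Mx v c r hr x hx).trans (hMv x)) hs0.le
  have e1 : (volume (cubeSet c r))⁻¹ * ∫⁻ y in cubeSet c r, u y ^ (1 - p) * v y ≤
      (K₁ : ℝ≥0∞) ^ (p - 1) * (U ^ (p - 1))⁻¹ * V := by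
    rw [hV, ← avgC_const_mul _ v hv]
    unfold avgC
    gcongr 1
    exact setLIntegral_mono (hv.const_mul _) h1
  have e2 : (volume (cubeSet c r))⁻¹ * ∫⁻ y in cubeSet c r, (u y ^ (1 - p) * v y) ^ (-s) ≤
      (K₂ : ℝ≥0∞) ^ s * (V ^ s)⁻¹ * U := by
    rw [hU, ← avgC_const_mul _ u hu]
    unfold avgC
    gcongr 1
    exact setLIntegral_mono_ae (hu.const_mul _).aemeasurable h2
  have hUp0 : U ^ (p - 1) ≠ 0 := by
    rw [Ne, ENNReal.rpow_eq_zero_iff_of_pos hp1]; exact hU0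
  have hUpt : U ^ (p - 1) ≠ ⊤ := ENNReal.rpow_ne_top_of_nonneg hp1.le hUt
  calc _ ≤ ((K₁ : ℝ≥0∞) ^ (p - 1) * (U ^ (p - 1))⁻¹ * V) *
        ((K₂ : ℝ≥0∞) ^ s * (V ^ s)⁻¹ * U) ^ (p - 1) := by gcongr
    _ = ((K₁ : ℝ≥0∞) ^ (p - 1) * (U ^ (p - 1))⁻¹ * V) * (K₂ * V⁻¹ * U ^ (p - 1)) := by
        congr 1
        rw [ENNReal.mul_rpow_of_nonneg _ _ hp1.le, ENNReal.mul_rpow_of_nonneg _ _ hp1.le,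
          ENNReal.inv_rpow, ← ENNReal.rpow_mul, ← ENNReal.rpow_mul, hsp, ENNReal.rpow_one,
          ENNReal.rpow_one]
    _ = (K₁ : ℝ≥0∞) ^ (p - 1) * K₂ * ((U ^ (p - 1))⁻¹ * U ^ (p - 1)) * (V⁻¹ * V) := by ring
    _ = _ := by
        rw [ENNReal.inv_mul_cancel hUp0 hUpt, ENNReal.inv_mul_cancel hV0 hVt, mul_one, mul_one]

lemma weight_isWeight {n : ℕ} (p : ℝ) (u v : Eucl n → ℝ≥0∞)
    (hu : Measurable u) (hv : Measurable v) (hupos : ∀ x, 0 < u x) (hvpos : ∀ x, 0 < v x)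
    (hufin : ∀ᵐ x, u x < ⊤) (hvfin : ∀ᵐ x, v x < ⊤) :
    IsWeight (fun x => u x ^ (1 - p) * v x) := by
  refine ⟨(hu.pow_const _).mul hv, ?_⟩
  filter_upwards [hufin, hvfin] with x hux hvx
  exact ⟨ENNReal.mul_pos (ENNReal.rpow_pos (hupos x) hux.ne).ne' (hvpos x).ne',
    ENNReal.mul_lt_top (ENNReal.rpow_ne_top_of_ne_zero (hupos x).ne' hux.ne).lt_top hvx⟩

lemma one_le_apConst {n : ℕ} (p : ℝ) (hp : 1 < p) (w : Eucl n → ℝ≥0∞) (hw : IsWeight w) :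
    1 ≤ apConst n p w := by
  refine le_trans ?_ (le_iSup_of_le (0 : Eucl n) <| le_iSup_of_le (1 : ℝ) <|
    le_iSup_of_le one_pos le_rfl)
  have hp0 : 0 < p := by linarith
  have hp1 : 0 < p - 1 := by linarith
  set Q := cubeSet (0 : Eucl n) 1 with hQ
  have hm0 : volume Q ≠ 0 := volume_cubeSet_ne_zero _ _ one_pos
  have hmt : volume Q ≠ ⊤ := volume_cubeSet_ne_top _ _ one_pos
  set m := volume Q with hm
  set I := ∫⁻ y in Q, w y with hI
  set J := ∫⁻ y in Q, w y ^ (-(1/(p-1))) with hJ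
  have hpq : p.HolderConjugate (p / (p - 1)) := Real.HolderConjugate.conjExponent hp
  have hhol := ENNReal.lintegral_mul_le_Lp_mul_Lq (volume.restrict Q) hpq
    (f := fun x => w x ^ (1 / p)) (g := fun x => w x ^ (-(1 / p)))
    (hw.1.pow_const _).aemeasurable (hw.1.pow_const _).aemeasurable
  have hl : ∫⁻ a in Q, ((fun x => w x ^ (1 / p)) * (fun x => w x ^ (-(1 / p)))) a = m := by
    have : ∫⁻ a in Q, ((fun x => w x ^ (1 / p)) * (fun x => w x ^ (-(1 / p)))) a
        = ∫⁻ a in Q, 1 := by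
      refine lintegral_congr_ae (ae_restrict_of_ae ?_)
      filter_upwards [hw.2] with x hx
      simp only [Pi.mul_apply]
      rw [← ENNReal.rpow_add _ _ hx.1.ne' hx.2.ne, add_neg_cancel, ENNReal.rpow_zero]
    rw [this]; simp [hm]
  have hr1 : ∀ x, (w x ^ (1 / p)) ^ p = w x := fun x => by
    rw [← ENNReal.rpow_mul, one_div_mul_cancel hp0.ne', ENNReal.rpow_one]
  have hr2 : ∀ x, (w x ^ (-(1 / p))) ^ (p / (p - 1)) = w x ^ (-(1 / (p - 1))) := fun x => by
    rw [← ENNReal.rpow_mul]; congr 1; field_simp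
  rw [hl] at hhol
  simp only [hr1, hr2] at hhol
  have h2 : m ^ p ≤ I * J ^ (p - 1) := by
    calc m ^ p ≤ (I ^ (1 / p) * J ^ (1 / (p / (p - 1)))) ^ p := ENNReal.rpow_le_rpow hhol hp0.le
      _ = _ := by
        rw [ENNReal.mul_rpow_of_nonneg _ _ hp0.le, ← ENNReal.rpow_mul, ← ENNReal.rpow_mul,
          one_div_mul_cancel hp0.ne', ENNReal.rpow_one]
        congr 2; field_simp
  calc (1 : ℝ≥0∞) = (m⁻¹) ^ p * m ^ p := by
        rw [← ENNReal.mul_rpow_of_nonneg _ _ hp0.le, ENNReal.inv_mul_cancel hm0 hmt, ENNReal.one_rpow]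
    _ ≤ (m⁻¹) ^ p * (I * J ^ (p - 1)) := by gcongr
    _ = m⁻¹ * (m⁻¹) ^ (p - 1) * (I * J ^ (p - 1)) := by
        congr 1
        conv_rhs => rw [← ENNReal.rpow_one (m⁻¹), ← ENNReal.rpow_mul, one_mul]
        rw [← ENNReal.rpow_add _ _ (ENNReal.inv_ne_zero.2 hmt) (ENNReal.inv_ne_top.2 hm0)]
        congr 1; ring
    _ = _ := by rw [ENNReal.mul_rpow_of_nonneg _ _ hp1.le]; ring

lemma weighted_est {n : ℕ} (p : ℝ) (hp : 1 < p) (N : ℝ → ℝ) (hN : MonotoneOn N (Set.Ici 1))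
    (hNpos : ∀ t, 1 ≤ t → 0 < N t) (u v : Eucl n → ℝ≥0∞)
    (hu : Measurable u) (hv : Measurable v) (hupos : ∀ x, 0 < u x) (hvpos : ∀ x, 0 < v x)
    (hufin : ∀ᵐ x, u x < ⊤) (hvfin : ∀ᵐ x, v x < ⊤) (K₁ K₂ : ℝ≥0) (hK₁ : 0 < K₁) (hK₂ : 0 < K₂)
    (hMu : ∀ x, Mx u x ≤ K₁ * u x) (hMv : ∀ x, Mx v x ≤ K₂ * v x)
    (K₀ : ℝ) (hK₀ : K₀ = ((K₁ : ℝ≥0∞) ^ (p - 1) * K₂).toReal)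
    (f g : Eucl n → ℝ) (hfg : memF n p N f g) (L₀ : ℝ≥0) (hL₀ : 0 < L₀)
    (hg : ∀ x, (‖g x‖₊ : ℝ≥0∞) ≤ L₀ * u x) :
    ∫⁻ x, (‖f x‖₊ : ℝ≥0∞) * v x ≤
      2 * (ENNReal.ofReal (N (max 1 K₀)) * L₀) * ∫⁻ x, u x * v x := by
  have hp0 : 0 < p := by linarith
  have hp1 : 0 < p - 1 := by linarith
  have huvm : Measurable fun x => u x * v x := hu.mul hv
  set w := fun x => u x ^ (1 - p) * v x with hw
  have hwW : IsWeight w := weight_isWeight p u v hu hv hupos hvpos hufin hvfin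
  have hap := ap_bound p hp u v hu hv hupos hvpos hufin hvfin K₁ K₂ hK₁ hK₂ hMu hMv
  have hKt : (K₁ : ℝ≥0∞) ^ (p - 1) * K₂ ≠ ⊤ :=
    ENNReal.mul_ne_top (ENNReal.rpow_ne_top_of_nonneg hp1.le (by simp)) (by simp)
  have hapt : apConst n p w < ⊤ := hap.trans_lt hKt.lt_top
  have h1 := one_le_apConst p hp w hwW
  have h1' : 1 ≤ (apConst n p w).toReal := by
    rw [← ENNReal.toReal_one]; exact ENNReal.toReal_mono hapt.ne h1
  have h2' : (apConst n p w).toReal ≤ max 1 K₀ :=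
    le_trans (by rw [hK₀]; exact ENNReal.toReal_mono hKt hap) (le_max_right _ _)
  have hNle : N (apConst n p w).toReal ≤ N (max 1 K₀) := hN h1' (Set.mem_Ici.2 (le_max_left _ _)) h2'
  have hN0 : 0 < N (max 1 K₀) := hNpos _ (le_max_left _ _)
  set c := ENNReal.ofReal (N (max 1 K₀)) with hc
  have hc0 : c ≠ 0 := by rw [hc, Ne, ENNReal.ofReal_eq_zero, not_le]; exact hN0
  have hct : c ≠ ⊤ := ENNReal.ofReal_ne_top
  have hmain : wLp n p w f ≤ c * wLp n p w g :=
    (hfg.2.2 w ⟨hwW, hapt⟩).trans (mul_le_mul_left (ENNReal.ofReal_le_ofReal hNle) _)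
  have hmain2 : ∫⁻ x, (‖f x‖₊ : ℝ≥0∞) ^ p * w x ≤ c ^ p * ∫⁻ x, (‖g x‖₊ : ℝ≥0∞) ^ p * w x := by
    have := ENNReal.rpow_le_rpow hmain hp0.le
    rw [ENNReal.mul_rpow_of_nonneg _ _ hp0.le] at this
    simpa only [wLp, wLpE, ← ENNReal.rpow_mul, one_div_mul_cancel hp0.ne', ENNReal.rpow_one] using this
  set L : ℝ≥0∞ := c * L₀ with hL
  have hL0 : L ≠ 0 := mul_ne_zero hc0 (by exact_mod_cast hL₀.ne')
  have hLt : L ≠ ⊤ := ENNReal.mul_ne_top hct (by simp)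
  have hgw : ∫⁻ x, (‖g x‖₊ : ℝ≥0∞) ^ p * w x ≤ (L₀ : ℝ≥0∞) ^ p * ∫⁻ x, u x * v x := by
    rw [← lintegral_const_mul _ huvm]
    refine lintegral_mono_ae ?_
    filter_upwards [hufin] with x hux
    have : u x ^ p * u x ^ (1 - p) = u x := by
      rw [← ENNReal.rpow_add _ _ (hupos x).ne' hux.ne, show p + (1 - p) = 1 by ring, ENNReal.rpow_one]
    calc (‖g x‖₊ : ℝ≥0∞) ^ p * w x ≤ (L₀ * u x) ^ p * w x := by gcongr; exact hg x
      _ = (L₀ : ℝ≥0∞) ^ p * ((u x ^ p * u x ^ (1 - p)) * v x) := by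
          rw [ENNReal.mul_rpow_of_nonneg _ _ hp0.le]; simp only [hw]; ring
      _ = _ := by rw [this]
  have hfw : ∫⁻ x, (‖f x‖₊ : ℝ≥0∞) ^ p * w x ≤ L ^ p * ∫⁻ x, u x * v x := by
    refine hmain2.trans ?_
    rw [hL, ENNReal.mul_rpow_of_nonneg _ _ hp0.le, mul_assoc]
    gcongr
  have hpt : ∀ᵐ x, (‖f x‖₊ : ℝ≥0∞) * v x ≤
      L * (u x * v x) + L ^ (1 - p) * ((‖f x‖₊ : ℝ≥0∞) ^ p * w x) := by
    filter_upwards [hufin] with x hux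
    by_cases hle : (‖f x‖₊ : ℝ≥0∞) ≤ L * u x
    · refine le_trans ?_ le_self_add
      rw [← mul_assoc]; gcongr
    · refine le_trans ?_ le_add_self
      have hlt := (not_le.1 hle).le
      have hLu0 : L * u x ≠ 0 := mul_ne_zero hL0 (hupos x).ne'
      have hLut : L * u x ≠ ⊤ := ENNReal.mul_ne_top hLt hux.ne
      have hf0 : (‖f x‖₊ : ℝ≥0∞) ≠ 0 := (pos_iff_ne_zero.2 hLu0 |>.trans_le hlt).ne'
      have e1 : (L * u x) ^ (p - 1) * (L * u x) ^ (1 - p) = 1 := by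
        rw [← ENNReal.rpow_add _ _ hLu0 hLut, show p - 1 + (1 - p) = 0 by ring, ENNReal.rpow_zero]
      have e2 : (‖f x‖₊ : ℝ≥0∞) ^ p = (‖f x‖₊ : ℝ≥0∞) * (‖f x‖₊ : ℝ≥0∞) ^ (p - 1) := by
        conv_rhs => rw [← ENNReal.rpow_one (‖f x‖₊ : ℝ≥0∞), ← ENNReal.rpow_mul, one_mul]
        rw [← ENNReal.rpow_add _ _ hf0 (by simp)]
        congr 1; ring
      calc (‖f x‖₊ : ℝ≥0∞) * v x
          = (‖f x‖₊ : ℝ≥0∞) * ((L * u x) ^ (p - 1) * (L * u x) ^ (1 - p)) * v x := by rw [e1, mul_one]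
        _ ≤ (‖f x‖₊ : ℝ≥0∞) * ((‖f x‖₊ : ℝ≥0∞) ^ (p - 1) * (L * u x) ^ (1 - p)) * v x := by gcongr
        _ = (‖f x‖₊ : ℝ≥0∞) ^ p * (L * u x) ^ (1 - p) * v x := by rw [e2]; ring
        _ = _ := by
          rw [ENNReal.mul_rpow_of_ne_zero hL0 (hupos x).ne']; simp only [hw]; ring
  have hLL : L ^ (1 - p) * L ^ p = L := by
    rw [← ENNReal.rpow_add _ _ hL0 hLt, show 1 - p + p = 1 by ring, ENNReal.rpow_one]
  calc ∫⁻ x, (‖f x‖₊ : ℝ≥0∞) * v x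
      ≤ ∫⁻ x, (L * (u x * v x) + L ^ (1 - p) * ((‖f x‖₊ : ℝ≥0∞) ^ p * w x)) := lintegral_mono_ae hpt
    _ = L * (∫⁻ x, u x * v x) + L ^ (1 - p) * ∫⁻ x, ((‖f x‖₊ : ℝ≥0∞) ^ p * w x) := by
        have hfm : Measurable fun x => (‖f x‖₊ : ℝ≥0∞) ^ p * w x :=
          (hfg.1.nnnorm.coe_nnreal_ennreal.pow_const _).mul hwW.1
        have hLm : Measurable fun x => L * (u x * v x) := huvm.const_mul _
        rw [lintegral_add_left hLm, lintegral_const_mul _ huvm,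
          lintegral_const_mul _ hfm]
    _ ≤ L * (∫⁻ x, u x * v x) + L ^ (1 - p) * (L ^ p * ∫⁻ x, u x * v x) := by gcongr
    _ = L * (∫⁻ x, u x * v x) + (L ^ (1 - p) * L ^ p) * ∫⁻ x, u x * v x := by ring
    _ = _ := by rw [hLL]; ring

/-! ### Main argument -/

lemma exists_pos_modular {n : ℕ} (E : ℝ≥0 → ℝ≥0∞) (s₀ : ℝ≥0) (hs₀ : 0 < s₀)
    (hfin : yconj E s₀ ≠ ⊤) :
    ∃ φ : Eucl n → ℝ≥0∞, Measurable φ ∧ (∀ x, 0 < φ x) ∧ ∫⁻ x, yconj E (φ x) ≤ 1 := by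
  obtain ⟨ρ, hρ0, hρm, hρ⟩ := exists_pos_lintegral_lt_of_sigmaFinite
    (volume : Measure (Eucl n)) (ε := (yconj E s₀)⁻¹) (ENNReal.inv_ne_zero.2 hfin)
  have hρm' : Measurable fun x => (min (ρ x) 1 : ℝ≥0) := hρm.min measurable_const
  have hms : Measurable fun x => ((min (ρ x) 1 : ℝ≥0) : ℝ≥0∞) := hρm'.coe_nnreal_ennreal
  refine ⟨fun x => ((min (ρ x) 1 : ℝ≥0) : ℝ≥0∞) * s₀, hms.mul_const _, fun x => ?_, ?_⟩
  · have : 0 < min (ρ x) 1 * s₀ := mul_pos (lt_min (hρ0 x) one_pos) hs₀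
    show (0:ℝ≥0∞) < ((min (ρ x) 1 : ℝ≥0) : ℝ≥0∞) * s₀
    exact_mod_cast this
  · calc ∫⁻ x, yconj E (((min (ρ x) 1 : ℝ≥0) : ℝ≥0∞) * s₀)
        ≤ ∫⁻ x, (ρ x : ℝ≥0∞) * yconj E s₀ := by
          refine lintegral_mono fun x => (yconj_smul_le E _ ?_ _).trans ?_
          · exact_mod_cast min_le_right _ _
          · gcongr; exact min_le_left _ _
      _ = (∫⁻ x, (ρ x : ℝ≥0∞)) * yconj E s₀ := lintegral_mul_const _ hρm.coe_nnreal_ennreal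
      _ ≤ (yconj E s₀)⁻¹ * yconj E s₀ := by gcongr
      _ ≤ 1 := ENNReal.inv_mul_le_one _

lemma lintegral_half {n : ℕ} {a b : Eucl n → ℝ≥0∞} (ha : Measurable a) (hb : Measurable b) :
    ∫⁻ x, (a x + b x) / 2 = ((∫⁻ x, a x) + ∫⁻ x, b x) / 2 := by
  simp only [div_eq_mul_inv]
  have hab : Measurable fun x => a x + b x := ha.add hb
  rw [lintegral_mul_const _ hab, lintegral_add_left ha]

lemma core {n : ℕ} (E : ℝ≥0 → ℝ≥0∞) (hEmono : Monotone E) (hE0 : E 0 = 0) (hEfin : ∀ t, E t ≠ ⊤)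
    (hslope : ∀ t : ℝ≥0, yconj E (E t / t) ≤ E t)
    (s₀ : ℝ≥0) (hs₀ : 0 < s₀) (hs₀fin : yconj E s₀ ≠ ⊤)
    (B₁ B₂ : ℝ≥0) (hB₁ : 0 < B₁) (hB₂ : 0 < B₂)
    (hmax₁ : ∀ g : Eucl n → ℝ≥0∞, Measurable g →
      ∫⁻ x, yconj (fun t : ℝ≥0 => yconj E t) (Mx g x / B₁) ≤
        ∫⁻ x, yconj (fun t : ℝ≥0 => yconj E t) (g x))
    (hmax₂ : ∀ g : Eucl n → ℝ≥0∞, Measurable g →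
      ∫⁻ x, yconj E (Mx g x / B₂) ≤ ∫⁻ x, yconj E (g x))
    (p : ℝ) (hp : 1 < p) (N : ℝ → ℝ) (hN : MonotoneOn N (Set.Ici 1))
    (hNpos : ∀ t, 1 ≤ t → 0 < N t) :
    ∃ K : ℝ≥0, 0 < K ∧ ∀ f g : Eucl n → ℝ, memF n p N f g → ∀ l : ℝ≥0, 0 < l →
      ∫⁻ x, E (‖g x‖₊ / l) ≤ 1 → ∫⁻ x, E (‖f x‖₊ / (K * l)) ≠ ⊤ →
      ∫⁻ x, E (‖f x‖₊ / (K * l)) ≤ 1 := by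
  set E' : ℝ≥0 → ℝ≥0∞ := fun t => yconj E t with hE'
  have hEm : Measurable E := hEmono.measurable
  obtain ⟨φ, hφm, hφ0, hφ1⟩ := exists_pos_modular (n := n) E' 1 one_pos
    (ne_top_of_le_ne_top (hEfin 1) (yconj_yconj_le E 1))
  obtain ⟨ψ, hψm, hψ0, hψ1⟩ := exists_pos_modular (n := n) E s₀ hs₀ hs₀fin
  set K₀ : ℝ := (((2 * B₁ : ℝ≥0) : ℝ≥0∞) ^ (p - 1) * ((2 * B₂ : ℝ≥0) : ℝ≥0∞)).toReal with hK₀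
  set N₀ : ℝ≥0 := (N (max 1 K₀)).toNNReal with hN₀
  have hN₀pos : 0 < N₀ := Real.toNNReal_pos.2 (hNpos _ (le_max_left _ _))
  refine ⟨64 * N₀, by positivity, fun f g hfg l hl hg1 hfin => ?_⟩
  set A := ∫⁻ x, E (‖f x‖₊ / (64 * N₀ * l)) with hA
  set F : Eucl n → ℝ≥0 := fun x => ‖f x‖₊ / (64 * N₀ * l) with hF
  have hFm : Measurable F := hfg.1.nnnorm.div_const _
  have hgm : Measurable fun x => ‖g x‖₊ / l := hfg.2.1.nnnorm.div_const _
  -- the majorant of `g`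
  set G : Eucl n → ℝ≥0∞ := fun x => (((‖g x‖₊ / l : ℝ≥0) : ℝ≥0∞) + φ x) / 2 with hG
  have hGm : Measurable G := (hgm.coe_nnreal_ennreal.add hφm).div_const _
  have hGint : ∫⁻ x, yconj E' (G x) ≤ 1 := by
    calc ∫⁻ x, yconj E' (G x) ≤ ∫⁻ x, (yconj E' ((‖g x‖₊ / l : ℝ≥0) : ℝ≥0∞) + yconj E' (φ x)) / 2 :=
          lintegral_mono fun x => yconj_half E' _ _
      _ = ((∫⁻ x, yconj E' ((‖g x‖₊ / l : ℝ≥0) : ℝ≥0∞)) + ∫⁻ x, yconj E' (φ x)) / 2 := by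
          have m1 : Measurable fun x => yconj E' ((‖g x‖₊ / l : ℝ≥0) : ℝ≥0∞) :=
            (yconj_measurable E').comp hgm.coe_nnreal_ennreal
          have m2 : Measurable fun x => yconj E' (φ x) := (yconj_measurable E').comp hφm
          exact lintegral_half m1 m2
      _ ≤ (1 + 1) / 2 := by
          gcongr
          exact (lintegral_mono fun x => yconj_yconj_le E _).trans hg1
      _ = 1 := by rw [one_add_one_eq_two]; exact ENNReal.div_self (by simp) (by simp)
  obtain ⟨u, hum, hGu, hMu, huint⟩ := exists_majorant E' B₁ hB₁ hmax₁ G hGm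
  -- the majorant of the dual function
  set h : Eucl n → ℝ≥0∞ := fun x => E (F x) / F x with hh
  have hhm : Measurable h := (hEm.comp hFm).div hFm.coe_nnreal_ennreal
  set H : Eucl n → ℝ≥0∞ := fun x => (h x + ψ x) / 2 with hH
  have hHm : Measurable H := (hhm.add hψm).div_const _
  have hHint : ∫⁻ x, yconj E (H x) ≤ (A + 1) / 2 := by
    calc ∫⁻ x, yconj E (H x) ≤ ∫⁻ x, (yconj E (h x) + yconj E (ψ x)) / 2 :=
          lintegral_mono fun x => yconj_half E _ _
      _ = ((∫⁻ x, yconj E (h x)) + ∫⁻ x, yconj E (ψ x)) / 2 := by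
          have m1 : Measurable fun x => yconj E (h x) := (yconj_measurable E).comp hhm
          have m2 : Measurable fun x => yconj E (ψ x) := (yconj_measurable E).comp hψm
          exact lintegral_half m1 m2
      _ ≤ (A + 1) / 2 := by
          gcongr
          exact lintegral_mono fun x => hslope _
  obtain ⟨v, hvm, hHv, hMv, hvint⟩ := exists_majorant E B₂ hB₂ hmax₂ H hHm
  have hle2 : ∀ a b : ℝ≥0∞, ∀ c : ℝ≥0∞, (a + b) / 2 ≤ 2 * c → a ≤ 4 * c := by
    intro a b c hab
    have h1 : a + b ≤ 2 * c * 2 := by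
      rwa [ENNReal.div_le_iff (by simp) (by simp)] at hab
    calc a ≤ a + b := le_self_add
      _ ≤ 2 * c * 2 := h1
      _ = 4 * c := by ring
  have hupos : ∀ x, 0 < u x := by
    intro x
    have h1 : φ x ≤ 4 * u x := hle2 _ ((‖g x‖₊ / l : ℝ≥0) : ℝ≥0∞) _ (by rw [add_comm]; exact hGu x)
    by_contra hcon
    have h2 : u x = 0 := by simpa using hcon
    rw [h2, mul_zero] at h1
    exact absurd h1 (not_le.2 (hφ0 x))
  have hvpos : ∀ x, 0 < v x := by
    intro x
    have h1 : ψ x ≤ 4 * v x := hle2 _ (h x) _ (by rw [add_comm]; exact hHv x)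
    by_contra hcon
    have h2 : v x = 0 := by simpa using hcon
    rw [h2, mul_zero] at h1
    exact absurd h1 (not_le.2 (hψ0 x))
  have hgu : ∀ x, (‖g x‖₊ : ℝ≥0∞) ≤ ((4 * l : ℝ≥0) : ℝ≥0∞) * u x := by
    intro x
    have h1 := hle2 _ _ _ (hGu x)
    have h2 : ‖g x‖₊ = l * (‖g x‖₊ / l) := by field_simp
    calc (‖g x‖₊ : ℝ≥0∞) = l * ((‖g x‖₊ / l : ℝ≥0) : ℝ≥0∞) := by rw [← ENNReal.coe_mul, ← h2]
      _ ≤ l * (4 * u x) := by gcongr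
      _ = _ := by push_cast; ring
  have hhv : ∀ x, h x ≤ 4 * v x := fun x => hle2 _ _ _ (hHv x)
  have huint1 := huint.trans hGint
  have hvint1 := hvint.trans hHint
  have hufin : ∀ᵐ x, u x < ⊤ := by
    have := ae_lt_top ((yconj_measurable E').comp hum) (huint1.trans_lt ENNReal.one_lt_top).ne
    filter_upwards [this] with x hx
    rw [lt_top_iff_ne_top]
    intro hcon
    simp only [Function.comp, hcon] at hx
    rw [yconj_top E' s₀ hs₀ hs₀fin] at hx
    exact lt_irrefl _ hx
  have hvfin : ∀ᵐ x, v x < ⊤ := by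
    have := ae_lt_top ((yconj_measurable E).comp hvm) (hvint1.trans_lt (ENNReal.div_lt_top
      (ENNReal.add_ne_top.2 ⟨hfin, by simp⟩) (by simp))).ne
    filter_upwards [this] with x hx
    rw [lt_top_iff_ne_top]
    intro hcon
    simp only [Function.comp, hcon] at hx
    rw [yconj_top E 1 one_pos (hEfin 1)] at hx
    exact lt_irrefl _ hx
  have hest := weighted_est p hp N hN hNpos u v hum hvm hupos hvpos hufin hvfin (2 * B₁) (2 * B₂)
    (by positivity) (by positivity) hMu hMv K₀ hK₀ f g hfg (4 * l) (by positivity) hgu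
  have huv : ∫⁻ x, u x * v x ≤ 1 + (A + 1) / 2 := by
    calc ∫⁻ x, u x * v x ≤ ∫⁻ x, (yconj E' (u x) + yconj E (v x)) := by
          refine lintegral_mono_ae ?_
          filter_upwards [hvfin] with x hx
          have := yconj_young E' (u x) (v x).toNNReal
          rw [ENNReal.coe_toNNReal hx.ne] at this
          rw [add_comm]
          simpa only [hE', ENNReal.coe_toNNReal hx.ne] using this
      _ = (∫⁻ x, yconj E' (u x)) + ∫⁻ x, yconj E (v x) :=
          lintegral_add_left ((yconj_measurable E').comp hum) _
      _ ≤ _ := add_le_add huint1 hvint1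
  have hFh : ∀ x, E (F x) = h x * F x := by
    intro x
    by_cases h0 : F x = 0
    · simp only [hh]; rw [h0, hE0]; simp
    · simp only [hh]
      rw [ENNReal.div_mul_cancel (by exact_mod_cast h0) (by simp)]
  have hAle : A ≤ 2⁻¹ * (1 + (A + 1) / 2) := by
    have hN₀' : ENNReal.ofReal (N (max 1 K₀)) = (N₀ : ℝ≥0∞) := rfl
    set κ : ℝ≥0 := (64 * N₀ * l)⁻¹ with hκ
    calc A = ∫⁻ x, h x * F x := lintegral_congr hFh
      _ ≤ ∫⁻ x, ((4 * κ : ℝ≥0) : ℝ≥0∞) * ((‖f x‖₊ : ℝ≥0∞) * v x) := by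
          refine lintegral_mono fun x => ?_
          have hFx : (F x : ℝ≥0∞) = (κ : ℝ≥0∞) * (‖f x‖₊ : ℝ≥0∞) := by
            rw [← ENNReal.coe_mul]; congr 1; simp only [hF, hκ]; rw [div_eq_mul_inv, mul_comm]
          rw [hFx]
          calc h x * ((κ : ℝ≥0∞) * (‖f x‖₊ : ℝ≥0∞)) ≤ 4 * v x * ((κ : ℝ≥0∞) * (‖f x‖₊ : ℝ≥0∞)) := by
                gcongr; exact hhv x
            _ = _ := by push_cast; ring
      _ = ((4 * κ : ℝ≥0) : ℝ≥0∞) * ∫⁻ x, (‖f x‖₊ : ℝ≥0∞) * v x :=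
          lintegral_const_mul _ (hfg.1.nnnorm.coe_nnreal_ennreal.mul hvm)
      _ ≤ ((4 * κ : ℝ≥0) : ℝ≥0∞) * (2 * (ENNReal.ofReal (N (max 1 K₀)) * ((4 * l : ℝ≥0) : ℝ≥0∞)) *
            ∫⁻ x, u x * v x) := by gcongr
      _ = ((4 * κ * (2 * (N₀ * (4 * l))) : ℝ≥0) : ℝ≥0∞) * ∫⁻ x, u x * v x := by
          rw [hN₀']; push_cast; ring
      _ = 2⁻¹ * ∫⁻ x, u x * v x := by
          have : (4 * κ * (2 * (N₀ * (4 * l))) : ℝ≥0) = 2⁻¹ := by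
            rw [hκ]; field_simp; norm_num
          rw [this, ENNReal.coe_inv (by simp)]; norm_num
      _ ≤ _ := by gcongr
  clear_value A
  lift A to ℝ≥0 using hfin
  have h5 : A ≤ 2⁻¹ * (1 + (A + 1) / 2) := by
    have e : ((2⁻¹ * (1 + (A + 1) / 2) : ℝ≥0) : ℝ≥0∞) = 2⁻¹ * (1 + ((A : ℝ≥0∞) + 1) / 2) := by
      rw [ENNReal.coe_mul, ENNReal.coe_inv (by simp), ENNReal.coe_add, ENNReal.coe_div (by simp)]
      push_cast; rfl
    rw [← e] at hAle
    exact_mod_cast hAle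
  have h6 : (A : ℝ) ≤ 2⁻¹ * (1 + (A + 1) / 2) := by exact_mod_cast h5
  have h7 : (A : ℝ) ≤ 1 := by linarith
  exact_mod_cast h7

lemma memF_indicator {n : ℕ} (p : ℝ) (hp : 1 < p) (N : ℝ → ℝ) (f g : Eucl n → ℝ)
    (hfg : memF n p N f g) (S : Set (Eucl n)) (hS : MeasurableSet S) :
    memF n p N (S.indicator f) g := by
  have hp0 : 0 < p := by linarith
  refine ⟨hfg.1.indicator hS, hfg.2.1, fun w hw => le_trans ?_ (hfg.2.2 w hw)⟩
  unfold wLp wLpE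
  refine ENNReal.rpow_le_rpow (lintegral_mono fun x => ?_) (by positivity)
  gcongr
  show (‖S.indicator f x‖₊ : ℝ≥0∞) ≤ ‖f x‖₊
  by_cases hx : x ∈ S
  · rw [Set.indicator_of_mem hx]
  · rw [Set.indicator_of_notMem hx]; simp

lemma core_full {n : ℕ} (E : ℝ≥0 → ℝ≥0∞) (hEmono : Monotone E) (hE0 : E 0 = 0)
    (hEfin : ∀ t, E t ≠ ⊤) (p : ℝ) (hp : 1 < p) (N : ℝ → ℝ) (K : ℝ≥0) (hK : 0 < K)
    (hcore : ∀ f g : Eucl n → ℝ, memF n p N f g → ∀ l : ℝ≥0, 0 < l →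
      ∫⁻ x, E (‖g x‖₊ / l) ≤ 1 → ∫⁻ x, E (‖f x‖₊ / (K * l)) ≠ ⊤ →
      ∫⁻ x, E (‖f x‖₊ / (K * l)) ≤ 1) (f g : Eucl n → ℝ) (hfg : memF n p N f g) (l : ℝ≥0)
    (hl : 0 < l) (hg : ∫⁻ x, E (‖g x‖₊ / l) ≤ 1) : ∫⁻ x, E (‖f x‖₊ / (K * l)) ≤ 1 := by
  set S : ℕ → Set (Eucl n) := fun m => {x | ‖f x‖₊ ≤ m} ∩ Metric.closedBall 0 m with hS
  have hSm : ∀ m, MeasurableSet (S m) := fun m =>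
    (measurableSet_le hfg.1.nnnorm measurable_const).inter Metric.isClosed_closedBall.measurableSet
  have hSmono : Monotone S := by
    intro m k hmk x hx
    have hmk' : (m : ℝ≥0) ≤ k := by exact_mod_cast hmk
    have hmk'' : (m : ℝ) ≤ k := by exact_mod_cast hmk
    exact ⟨(show ‖f x‖₊ ≤ m from hx.1).trans hmk', Metric.closedBall_subset_closedBall hmk'' hx.2⟩
  have hSU : ⋃ m, S m = Set.univ := by
    rw [Set.eq_univ_iff_forall]
    intro x
    obtain ⟨m, hm⟩ := exists_nat_ge (max ‖f x‖ ‖x‖)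
    refine Set.mem_iUnion.2 ⟨m, ?_, ?_⟩
    · have : ‖f x‖ ≤ m := (le_max_left _ _).trans hm
      show ‖f x‖₊ ≤ m
      exact_mod_cast this
    · rw [mem_closedBall_zero_iff]; exact (le_max_right _ _).trans hm
  have heq : ∀ m, ∫⁻ x, E (‖(S m).indicator f x‖₊ / (K * l)) = ∫⁻ x in S m, E (‖f x‖₊ / (K * l)) := by
    intro m
    rw [← lintegral_indicator (hSm m)]
    refine lintegral_congr fun x => ?_
    by_cases hx : x ∈ S m
    · rw [Set.indicator_of_mem hx, Set.indicator_of_mem hx]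
    · rw [Set.indicator_of_notMem hx, Set.indicator_of_notMem hx]; simp [hE0]
  have hone : ∀ m, ∫⁻ x in S m, E (‖f x‖₊ / (K * l)) ≤ 1 := by
    intro m
    rw [← heq]
    refine hcore _ g (memF_indicator p hp N f g hfg _ (hSm m)) l hl hg ?_
    rw [heq]
    have hle : ∫⁻ x in S m, E (‖f x‖₊ / (K * l)) ≤ ∫⁻ _ in S m, E (m / (K * l)) := by
      refine setLIntegral_mono measurable_const fun x hx => hEmono ?_
      have : ‖f x‖₊ ≤ m := hx.1
      gcongr
    refine ne_top_of_le_ne_top ?_ hle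
    rw [setLIntegral_const]
    refine ENNReal.mul_ne_top (hEfin _) ?_
    refine ne_top_of_le_ne_top ?_ (measure_mono Set.inter_subset_right)
    exact (isCompact_closedBall (0 : Eucl n) (m : ℝ)).measure_lt_top.ne
  rw [← setLIntegral_univ, ← hSU, setLIntegral_iUnion_of_directed _ (hSmono.directed_le)]
  exact iSup_le hone

/-- **Extrapolation in Orlicz spaces `L^Φ` with `Φ ∈ Δ₂ ∩ ∇₂`.** -/
theorem extrapolation_orlicz (n : ℕ) (hn : 1 ≤ n) (Φ : ℝ → ℝ)
    (hconv : ConvexOn ℝ (Set.Ici 0) Φ)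
    (hbij : Set.BijOn Φ (Set.Ici 0) (Set.Ici 0))
    (C₁ : ℝ) (hC₁ : 0 < C₁) (hDelta2 : ∀ t : ℝ, 0 < t → Φ (2 * t) ≤ C₁ * Φ t)
    (C₂ : ℝ) (hC₂ : 1 < C₂) (hNabla2 : ∀ t : ℝ, 0 ≤ t → 2 * C₂ * Φ t ≤ Φ (2 * t))
    (p : ℝ) (hp : 1 < p)
    (N : ℝ → ℝ) (hN : MonotoneOn N (Set.Ici 1)) (hNpos : ∀ t, 1 ≤ t → 0 < N t) :
    ∃ C : ℝ, 0 < C ∧ ∀ f g : Eucl n → ℝ, memF n p N f g →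
      luxNorm n Φ f ≤ ENNReal.ofReal C * luxNorm n Φ g := by
  have hpos : ∀ t, 0 ≤ t → 0 ≤ Φ t := fun t ht => hbij.mapsTo ht
  have hΦ0 : Φ 0 = 0 := by
    have h1 := hNabla2 0 le_rfl
    have h2 := hpos 0 le_rfl
    rw [mul_zero] at h1
    nlinarith
  have hΦ1 : 0 < Φ 1 := by
    refine lt_of_le_of_ne (hpos 1 zero_le_one) fun h => ?_
    have := hbij.injOn (show (0 : ℝ) ∈ Set.Ici 0 by simp) (show (1 : ℝ) ∈ Set.Ici 0 by simp)
      (by rw [hΦ0, h])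
    norm_num at this
  have hstar : ∀ θ u : ℝ, 0 ≤ θ → θ ≤ 1 → 0 ≤ u → Φ (θ * u) ≤ θ * Φ u := by
    intro θ u h0 h1 hu
    have := hconv.2 (show (0 : ℝ) ∈ Set.Ici 0 by simp) (show u ∈ Set.Ici 0 from hu)
      (sub_nonneg.2 h1) h0 (by ring)
    simpa [hΦ0] using this
  have hslopeR : ∀ t u : ℝ, 0 < t → t ≤ u → Φ t * u ≤ t * Φ u := by
    intro t u ht htu
    have hu : 0 < u := ht.trans_le htu
    have := hstar (t / u) u (by positivity) ((div_le_one hu).2 htu) hu.le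
    rw [div_mul_cancel₀ _ hu.ne', div_mul_eq_mul_div, le_div_iff₀ hu] at this
    exact this
  have hmonoR : ∀ t u : ℝ, 0 ≤ t → t ≤ u → Φ t ≤ Φ u := by
    intro t u ht htu
    rcases ht.eq_or_lt with h | h
    · rw [← h, hΦ0]; exact hpos u (ht.trans htu)
    · have h1 := hslopeR t u h htu
      have h2 := hpos u (ht.trans htu)
      have hu : 0 < u := h.trans_le htu
      have : Φ t * u ≤ Φ u * u := h1.trans (by nlinarith)
      exact le_of_mul_le_mul_right this hu
  have hC₁2 : 2 < C₁ := by
    have h1 := hDelta2 1 one_pos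
    have h2 := hNabla2 1 zero_le_one
    by_contra hcon
    nlinarith
  lift C₁ to ℝ≥0 using hC₁.le
  lift C₂ to ℝ≥0 using (zero_lt_one.trans hC₂).le
  have hC₂' : 1 < C₂ := by exact_mod_cast hC₂
  have hC₁' : 2 < C₁ := by exact_mod_cast hC₁2
  set E : ℝ≥0 → ℝ≥0∞ := fun t => ENNReal.ofReal (Φ t) with hE
  have hEmono : Monotone E := fun t u htu => ENNReal.ofReal_le_ofReal (hmonoR t u t.2 (by exact_mod_cast htu))
  have hE0 : E 0 = 0 := by simp [hE, hΦ0]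
  have hEfin : ∀ t, E t ≠ ⊤ := fun t => ENNReal.ofReal_ne_top
  have hslope : ∀ t : ℝ≥0, yconj E (E t / t) ≤ E t := by
    intro t
    by_cases ht : t = 0
    · subst ht; rw [hE0]; simp [yconj_zero]
    have ht' : (t : ℝ≥0∞) ≠ 0 := by exact_mod_cast ht
    have ht0 : 0 < t := pos_iff_ne_zero.2 ht
    rw [yconj_le_iff]
    intro u
    have hrw : E t / t * u = (E t * u) / t := by simp only [div_eq_mul_inv]; ring
    rw [hrw, ENNReal.div_le_iff ht' (by simp)]
    rcases le_total t u with htu | hut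
    · have h1 : E t * u ≤ t * E u := by
        have := ENNReal.ofReal_le_ofReal (hslopeR t u (by exact_mod_cast ht0) (by exact_mod_cast htu))
        rw [ENNReal.ofReal_mul (hpos t t.2), ENNReal.ofReal_mul (NNReal.coe_nonneg t)] at this
        simpa only [ENNReal.ofReal_coe_nnreal] using this
      refine h1.trans ?_
      rw [mul_comm]; gcongr; exact le_self_add
    · gcongr
      exact le_add_self
  set s₀ : ℝ≥0 := (Φ 1).toNNReal with hs₀
  have hs₀pos : 0 < s₀ := Real.toNNReal_pos.2 hΦ1
  have hs₀fin : yconj E s₀ ≠ ⊤ := by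
    have := hslope 1
    rw [ENNReal.coe_one, div_one] at this
    have e : E 1 = (s₀ : ℝ≥0∞) := by simp only [hE, hs₀, NNReal.coe_one]; rfl
    rw [← e]
    exact ne_top_of_le_ne_top (hEfin 1) this
  -- growth of the conjugate
  have hgrow₂ : ∀ s, ((C₁ / 2 * 2 : ℝ≥0) : ℝ≥0∞) * yconj E s ≤ yconj E ((C₁ / 2 : ℝ≥0) * s) := by
    intro s
    rw [div_mul_cancel₀ _ (by norm_num)]
    refine yconj_grow E C₁ 2 (by norm_num) (fun t => ?_) s
    by_cases ht : t = 0
    · subst ht; simp [hE0]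
    have ht0 : (0 : ℝ) < t := by exact_mod_cast pos_iff_ne_zero.2 ht
    have := ENNReal.ofReal_le_ofReal (hDelta2 t ht0)
    rw [ENNReal.ofReal_mul (NNReal.coe_nonneg C₁), ENNReal.ofReal_coe_nnreal] at this
    simpa only [hE, NNReal.coe_mul, NNReal.coe_ofNat] using this
  have hdbl : ∀ s : ℝ≥0∞, yconj E ((C₂ : ℝ≥0∞) * s) ≤ ((2 * C₂ : ℝ≥0) : ℝ≥0∞) * yconj E s := by
    intro s
    have := yconj_dbl E (2 * C₂) 2 (by norm_num) (fun t => ?_) s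
    · rwa [mul_div_cancel_left₀ _ (by norm_num)] at this
    · have := ENNReal.ofReal_le_ofReal (hNabla2 t t.2)
      rw [ENNReal.ofReal_mul (by positivity)] at this
      have e : ENNReal.ofReal (2 * (C₂ : ℝ)) = ((2 * C₂ : ℝ≥0) : ℝ≥0∞) := by
        rw [← ENNReal.ofReal_coe_nnreal]; norm_num
      rw [e] at this
      simpa only [hE, NNReal.coe_mul, NNReal.coe_ofNat] using this
  have hgrow₁ : ∀ s, ((2 * C₂ : ℝ≥0) : ℝ≥0∞) * yconj (fun t : ℝ≥0 => yconj E t) s ≤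
      yconj (fun t : ℝ≥0 => yconj E t) ((2 : ℝ≥0) * s) := by
    intro s
    have hC₂0 : 0 < C₂ := zero_lt_one.trans hC₂'
    have := yconj_grow (fun t : ℝ≥0 => yconj E t) (2 * C₂) C₂ hC₂0
      (fun t => by rw [ENNReal.coe_mul]; exact hdbl t) s
    rwa [mul_div_cancel_right₀ _ hC₂0.ne'] at this
  obtain ⟨B₁, hB₁, hmax₁⟩ := maxi hn (fun t : ℝ≥0 => yconj E t) s₀ hs₀pos hs₀fin 2 C₂ (by norm_num)
    hC₂' hgrow₁
  obtain ⟨B₂, hB₂, hmax₂⟩ := maxi hn E 1 one_pos (hEfin 1) (C₁ / 2) 2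
    (by rw [lt_div_iff₀ (by norm_num)]; simpa using hC₁') (by norm_num) hgrow₂
  obtain ⟨K, hK, hcore⟩ := core E hEmono hE0 hEfin hslope s₀ hs₀pos hs₀fin B₁ B₂ hB₁ hB₂ hmax₁ hmax₂
    p hp N hN hNpos
  refine ⟨K, by exact_mod_cast hK, fun f g hfg => ?_⟩
  have hconvE : ∀ (f : Eucl n → ℝ) (l : ℝ≥0),
      ∫⁻ x, ENNReal.ofReal (Φ (|f x| / l)) = ∫⁻ x, E (‖f x‖₊ / l) := by
    intro f l
    refine lintegral_congr fun x => ?_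
    simp only [hE, NNReal.coe_div, coe_nnnorm, Real.norm_eq_abs]
  have hK0 : (K : ℝ≥0∞) ≠ 0 := by exact_mod_cast hK.ne'
  rw [ENNReal.ofReal_coe_nnreal, mul_comm, ← ENNReal.div_le_iff hK0 (by simp)]
  refine le_sInf ?_
  rintro t ⟨l, hl, rfl, hlint⟩
  lift l to ℝ≥0 using hl.le
  have hl' : 0 < l := by exact_mod_cast hl
  rw [hconvE] at hlint
  have hfin := core_full E hEmono hE0 hEfin p hp N K hK hcore f g hfg l hl' hlint
  rw [ENNReal.div_le_iff hK0 (by simp)]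
  refine sInf_le ⟨((K * l : ℝ≥0) : ℝ), by positivity, ?_, ?_⟩
  · rw [ENNReal.ofReal_coe_nnreal, ENNReal.ofReal_coe_nnreal, ENNReal.coe_mul, mul_comm]
  · rw [hconvE]; exact hfin
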